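/- arXiv:2402.08819 — 9 statements merged into one kernel-verified Lean document; each statement's English description precedes it below -/
import Mathlib

section
/- Existence of a solution to the average-cost Bellman optimality equation (Proposition 1, explicit form): there exist a constant j* ∈ ℝ and a bounded continuous function h : ℝⁿ → ℝ with h(0) = 0 such that for every e ∈ ℝⁿ, j* + h(e) = min( θ + ∫_{ℝⁿ} h(y) p_Ξ(y) dy , eᵀAᵀΣA e + ∫_{ℝⁿ} h(y) p_Ξ(y − A e) dy ). -/
open MeasureTheory Matrix

/-- Gaussian density with covariance `Ξ` on `ℝⁿ`. -/
noncomputable def gaussDensity (n : ℕ) (Ξ : Matrix (Fin n) (Fin n) ℝ) (y : Fin n → ℝ) : ℝ :=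
  (2 * Real.pi) ^ (-(n : ℝ) / 2) * Ξ.det ^ (-(1 : ℝ) / 2) *
    Real.exp (-(1 / 2) * (y ⬝ᵥ Ξ⁻¹.mulVec y))


/-- noise kernel -/
noncomputable def PP {n : ℕ} (p g : (Fin n → ℝ) → ℝ) (x : Fin n → ℝ) : ℝ := ∫ y, g y * p (y - x)

/-- a nice density -/
structure NiceD {n : ℕ} (p : (Fin n → ℝ) → ℝ) : Prop where
  cont : Continuous p
  pos : ∀ x, 0 < p x
  int : Integrable p
  one : ∫ x, p x = 1

section
variable {n : ℕ} {p : (Fin n → ℝ) → ℝ}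

lemma NiceD.int_shift (hp : NiceD p) (x : Fin n → ℝ) : Integrable (fun y => p (y - x)) :=
  hp.int.comp_sub_right x

lemma NiceD.one_shift (hp : NiceD p) (x : Fin n → ℝ) : ∫ y, p (y - x) = 1 := by
  rw [integral_sub_right_eq_self (fun y => p y) x]; exact hp.one

lemma PP_integrable (hp : NiceD p) {g : (Fin n → ℝ) → ℝ} (hg : Continuous g) {C : ℝ}
    (hC : ∀ x, |g x| ≤ C) (x : Fin n → ℝ) : Integrable (fun y => g y * p (y - x)) :=
  (hp.int_shift x).bdd_mul (c := C) hg.aestronglyMeasurable (Filter.Eventually.of_forall hC)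

lemma PP_shift (p g : (Fin n → ℝ) → ℝ) (x : Fin n → ℝ) : PP p g x = ∫ w, g (w + x) * p w := by
  unfold PP
  rw [← integral_add_right_eq_self (fun y => g y * p (y - x)) x]
  simp

lemma PP_int_shift (hp : NiceD p) {g : (Fin n → ℝ) → ℝ} (hg : Continuous g) {C : ℝ}
    (hC : ∀ x, |g x| ≤ C) (x : Fin n → ℝ) : Integrable (fun w => g (w + x) * p w) :=
  hp.int.bdd_mul (c := C) (by fun_prop) (Filter.Eventually.of_forall fun w => hC _)

lemma PP_mono' (hp : NiceD p) {f g : (Fin n → ℝ) → ℝ} (hf : Continuous f) (hg : Continuous g)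
    {C C' : ℝ} (hC : ∀ x, |f x| ≤ C) (hC' : ∀ x, |g x| ≤ C') {D : ℝ} {x x' : Fin n → ℝ}
    (h : ∀ w, f (w + x) ≤ g (w + x') + D) : PP p f x ≤ PP p g x' + D := by
  rw [PP_shift, PP_shift]
  have e : (∫ w, g (w + x') * p w) + D = ∫ w, (g (w + x') * p w + D * p w) := by
    rw [integral_add (PP_int_shift hp hg hC' x') (hp.int.const_mul D), integral_const_mul, hp.one,
      mul_one]
  rw [e]
  refine integral_mono (PP_int_shift hp hf hC x)
    ((PP_int_shift hp hg hC' x').add (hp.int.const_mul D)) fun w => ?_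
  have := mul_le_mul_of_nonneg_right (h w) (hp.pos w).le
  simp only
  linarith

lemma PP_const (hp : NiceD p) (D : ℝ) (x : Fin n → ℝ) : PP p (fun _ => D) x = D := by
  unfold PP
  rw [integral_const_mul, hp.one_shift, mul_one]

lemma PP_const_sub (hp : NiceD p) {g : (Fin n → ℝ) → ℝ} (hg : Continuous g) {C : ℝ}
    (hC : ∀ x, |g x| ≤ C) (D : ℝ) (x : Fin n → ℝ) :
    PP p (fun y => D - g y) x = D - PP p g x := by
  unfold PP
  simp only [sub_mul]
  rw [integral_sub ((hp.int_shift x).const_mul D) (PP_integrable hp hg hC x), integral_const_mul,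
    hp.one_shift, mul_one]

lemma PP_nonneg (hp : NiceD p) {g : (Fin n → ℝ) → ℝ} (hg : ∀ x, 0 ≤ g x) (x : Fin n → ℝ) :
    0 ≤ PP p g x := integral_nonneg fun y => mul_nonneg (hg y) (hp.pos _).le

lemma PP_abs_le (hp : NiceD p) {g : (Fin n → ℝ) → ℝ} (hg : Continuous g) {C : ℝ}
    (hC : ∀ x, |g x| ≤ C) (x : Fin n → ℝ) : |PP p g x| ≤ C := by
  have h1 := PP_mono' hp (f := g) (g := fun _ => 0) (D := C) (x := x) (x' := x) hg continuous_const hC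
    (C' := 0) (by simp) (fun w => by simpa using (abs_le.1 (hC _)).2)
  have h2 := PP_mono' hp (f := fun _ => 0) (g := g) (D := C) (x := x) (x' := x) continuous_const hg
    (C := 0) (by simp) hC (fun w => by linarith [(abs_le.1 (hC (w + x))).1])
  rw [PP_const hp] at h1 h2
  rw [abs_le]; constructor <;> linarith

/-- L1 modulus -/
noncomputable def L1mod (p : (Fin n → ℝ) → ℝ) (x x' : Fin n → ℝ) : ℝ :=
  ∫ y, |p (y - x) - p (y - x')|

lemma L1mod_tendsto (hp : NiceD p) (x : Fin n → ℝ) :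
    Filter.Tendsto (L1mod p x) (nhds x) (nhds 0) := by
  have e : ∀ x', L1mod p x x' = ∫ y, 2 * max (p (y - x) - p (y - x')) 0 := by
    intro x'
    have i1 : Integrable (fun y => p (y - x) - p (y - x')) :=
      (hp.int_shift x).sub (hp.int_shift x')
    have : (fun y => 2 * max (p (y - x) - p (y - x')) 0) =
        fun y => |p (y - x) - p (y - x')| + (p (y - x) - p (y - x')) := by
      ext y
      rcases le_total 0 (p (y - x) - p (y - x')) with h | h
      · rw [abs_of_nonneg h, max_eq_left h]; ring
      · rw [abs_of_nonpos h, max_eq_right h]; ring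
    rw [this, integral_add i1.abs i1, integral_sub (hp.int_shift x) (hp.int_shift x'),
      hp.one_shift, hp.one_shift]
    simp [L1mod]
  rw [show L1mod p x = _ from funext e]
  have hc := hp.cont
  rw [show nhds (0:ℝ) = nhds (∫ y : Fin n → ℝ, (0:ℝ)) by simp]
  refine tendsto_integral_filter_of_dominated_convergence (fun y => 2 * p (y - x)) ?_ ?_
    ((hp.int_shift x).const_mul 2) ?_
  · exact Filter.Eventually.of_forall fun x' => (by fun_prop : Continuous _).aestronglyMeasurable
  · refine Filter.Eventually.of_forall fun x' => Filter.Eventually.of_forall fun y => ?_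
    have h1 := (hp.pos (y - x)).le
    have h2 := (hp.pos (y - x')).le
    rw [Real.norm_eq_abs, abs_of_nonneg (by positivity)]
    have : max (p (y - x) - p (y - x')) 0 ≤ p (y - x) := max_le (by linarith) h1
    linarith
  · refine Filter.Eventually.of_forall fun y => ?_
    have : Continuous fun x' => 2 * max (p (y - x) - p (y - x')) 0 := by fun_prop
    have := this.tendsto x
    simpa using this

lemma PP_modulus (hp : NiceD p) {g : (Fin n → ℝ) → ℝ} (hg : Continuous g) {C : ℝ}
    (hC : ∀ x, |g x| ≤ C) (x x' : Fin n → ℝ) : |PP p g x - PP p g x'| ≤ C * L1mod p x x' := by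
  have i1 := (hp.int_shift x).sub (hp.int_shift x')
  unfold PP L1mod
  rw [← integral_sub (PP_integrable hp hg hC x) (PP_integrable hp hg hC x'), ← integral_const_mul]
  refine (abs_integral_le_integral_abs).trans ?_
  refine integral_mono ((PP_integrable hp hg hC x).sub (PP_integrable hp hg hC x')).abs
    (i1.abs.const_mul C) fun y => ?_
  simp only
  rw [← mul_sub, abs_mul]
  exact mul_le_mul_of_nonneg_right (hC y) (abs_nonneg _)

lemma PP_continuous (hp : NiceD p) {g : (Fin n → ℝ) → ℝ} (hg : Continuous g) {C : ℝ}
    (hC : ∀ x, |g x| ≤ C) : Continuous (PP p g) := by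
  rw [continuous_iff_continuousAt]
  intro x
  rw [ContinuousAt, tendsto_iff_dist_tendsto_zero]
  have h := (L1mod_tendsto hp x).const_mul C
  rw [mul_zero] at h
  refine squeeze_zero (fun _ => dist_nonneg) (fun x' => ?_) h
  rw [dist_comm, Real.dist_eq]
  exact PP_modulus hp hg hC x x'

/-- tail bound -/
lemma exists_tail (hp : NiceD p) : ∃ R : ℝ, 0 ≤ R ∧ ∫ w in {w | R < ‖w‖}, p w ≤ 1 / 2 := by
  have h : Filter.Tendsto (fun k : ℕ => ∫ w in {w : Fin n → ℝ | (k:ℝ) < ‖w‖}, p w) Filter.atTop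
      (nhds (∫ w in ⋂ k : ℕ, {w : Fin n → ℝ | (k:ℝ) < ‖w‖}, p w)) := by
    refine tendsto_setIntegral_of_antitone (fun k => ?_) ?_ ⟨0, hp.int.integrableOn⟩
    · exact measurableSet_lt measurable_const measurable_norm
    · intro a b hab w hw
      have : (a:ℝ) ≤ b := by exact_mod_cast hab
      exact lt_of_le_of_lt this hw
  have e : ⋂ k : ℕ, {w : Fin n → ℝ | (k:ℝ) < ‖w‖} = ∅ := by
    ext w
    simp only [Set.mem_iInter, Set.mem_ofPred_eq, Set.mem_empty_iff_false, iff_false, not_forall, not_lt]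
    exact exists_nat_ge _
  rw [e] at h
  simp only [Measure.restrict_empty, integral_zero_measure] at h
  obtain ⟨k, hk⟩ := (h.eventually (ge_mem_nhds (show (0:ℝ) < 1/2 by norm_num))).exists
  exact ⟨k, by positivity, hk⟩

lemma extract (G : ℝ) (ω : (Fin n → ℝ) → (Fin n → ℝ) → ℝ)
    (hω : ∀ x, Filter.Tendsto (ω x) (nhds x) (nhds 0)) (g : ℕ → (Fin n → ℝ) → ℝ)
    (h1 : ∀ k x, g k x ∈ Set.Icc 0 G) (h2 : ∀ k x y, |g k x - g k y| ≤ ω x y) :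
    ∃ (φ : ℕ → ℕ) (f : (Fin n → ℝ) → ℝ), StrictMono φ ∧ Continuous f ∧
      ∀ x, Filter.Tendsto (fun k => g (φ k) x) Filter.atTop (nhds (f x)) := by
  have cont : ∀ f : (Fin n → ℝ) → ℝ, (∀ x y, |f x - f y| ≤ ω x y) → Continuous f := by
    intro f hf
    rw [continuous_iff_continuousAt]
    intro x
    rw [ContinuousAt, tendsto_iff_dist_tendsto_zero]
    refine squeeze_zero (fun _ => dist_nonneg) (fun x' => ?_) (hω x)
    rw [dist_comm, Real.dist_eq]
    exact hf x x'
  let S : Set C(Fin n → ℝ, ℝ) := {f | (∀ x, f x ∈ Set.Icc 0 G) ∧ ∀ x y, |f x - f y| ≤ ω x y}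
  have hS : IsCompact S := by
    apply ArzelaAscoli.isCompact_of_equicontinuous
    · have : ContinuousMap.toFun '' S = (Set.pi Set.univ fun _ => Set.Icc 0 G) ∩
          {f | ∀ x y, |f x - f y| ≤ ω x y} := by
        ext f
        constructor
        · rintro ⟨f, hf, rfl⟩
          exact ⟨fun x _ => hf.1 x, hf.2⟩
        · rintro ⟨a, b⟩
          exact ⟨⟨f, cont f b⟩, ⟨fun x => a x trivial, b⟩, rfl⟩
      rw [this]
      refine (isCompact_univ_pi fun _ => isCompact_Icc).inter_right ?_
      simp only [Set.ofPred_forall]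
      refine isClosed_iInter fun x => isClosed_iInter fun y => ?_
      exact isClosed_le (by fun_prop) continuous_const
    · intro x
      rw [Metric.equicontinuousAt_iff_right]
      intro ε hε
      filter_upwards [(hω x).eventually (gt_mem_nhds hε)] with y hy f
      rw [Real.dist_eq]
      exact (f.2.2 x y).trans_lt hy
  obtain ⟨f, hf, φ, hφ, ht⟩ := hS.tendsto_subseq (x := fun k => ⟨g k, cont _ (h2 k)⟩)
    (fun k => ⟨h1 k, h2 k⟩)
  refine ⟨φ, f, hφ, f.continuous, fun x => ?_⟩
  exact ((continuous_eval_const x).tendsto f).comp ht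

end
section
variable {n : ℕ} {p : (Fin n → ℝ) → ℝ}

/-- The cost hypotheses -/
structure CostD (A M : (Fin n → ℝ) →L[ℝ] (Fin n → ℝ)) (c : (Fin n → ℝ) → ℝ) : Prop where
  cont : Continuous c
  zero : c 0 = 0
  lower : ∀ x, ‖M x‖ ^ 2 ≤ c x
  inv : ∀ x u, M u = 0 → c (x + u) = c x

/-- Set of admissible relative gains -/
structure Adm (p : (Fin n → ℝ) → ℝ) (A M : (Fin n → ℝ) →L[ℝ] (Fin n → ℝ)) (c : (Fin n → ℝ) → ℝ)
    (θ : ℝ) (g : (Fin n → ℝ) → ℝ) : Prop where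
  cont : Continuous g
  nonneg : ∀ x, 0 ≤ g x
  bdd : ∃ C, ∀ x, g x ≤ C
  le : ∀ x, g x ≤ max 0 (θ - c x + PP p g (A x))
  zero : PP p g 0 ≤ 2 * θ
  inv : ∀ x u, (∀ k : ℕ, M ((A ^ k) u) = 0) → g (x + u) = g x

lemma claim (hp : NiceD p) {A M : (Fin n → ℝ) →L[ℝ] (Fin n → ℝ)} {c : (Fin n → ℝ) → ℝ}
    (hc : CostD A M c) {θ : ℝ} (hθ : 0 < θ) (k : ℕ) : ∀ D : ℝ, 0 ≤ D → ∃ r K : ℝ,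
    ∀ g, Adm p A M c θ g → ∀ G, K ≤ G → (∀ x, g x ≤ G) → ∀ e, r ≤ ‖M ((A ^ k) e)‖ → g e ≤ G - D := by
  induction k with
  | zero =>
    intro D hD
    refine ⟨D + θ + 1, D, fun g hg G hG hgG e he => ?_⟩
    have habs : ∀ x, |g x| ≤ G := fun x => by rw [abs_of_nonneg (hg.nonneg x)]; exact hgG x
    have h1 := (abs_le.1 (PP_abs_le hp hg.cont habs (A e))).2
    have h2 := hc.lower e
    simp only [pow_zero, one_apply_eq_self] at he
    refine (hg.le e).trans (max_le (by linarith) ?_)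
    nlinarith
  | succ k ih =>
    intro D hD
    obtain ⟨r, K, h⟩ := ih (2 * (D + θ)) (by linarith)
    obtain ⟨R, hR0, hR⟩ := exists_tail hp
    refine ⟨r + ‖M.comp (A ^ k)‖ * R, max K D, fun g hg G hG hgG e he => ?_⟩
    have habs : ∀ x, |g x| ≤ G := fun x => by rw [abs_of_nonneg (hg.nonneg x)]; exact hgG x
    have hG1 := (le_max_left _ _).trans hG
    have hG2 := (le_max_right _ _).trans hG
    have hcn : 0 ≤ c e := (sq_nonneg _).trans (hc.lower e)
    have hms : MeasurableSet {w : Fin n → ℝ | R < ‖w‖} :=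
      measurableSet_lt measurable_const measurable_norm
    have key : PP p g (A e) ≤ G - (D + θ) := by
      rw [PP_shift]
      have i1 : Integrable (fun w => (G - 2 * (D + θ)) * p w) := hp.int.const_mul _
      have i2 : Integrable (fun w => 2 * (D + θ) * ({w : Fin n → ℝ | R < ‖w‖}.indicator p w)) :=
        (hp.int.indicator hms).const_mul _
      calc ∫ w, g (w + A e) * p w
          ≤ ∫ w, ((G - 2 * (D + θ)) * p w + 2 * (D + θ) * ({w : Fin n → ℝ | R < ‖w‖}.indicator p w)) := by
            refine integral_mono (PP_int_shift hp hg.cont habs _) (i1.add i2) fun w => ?_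
            have hpw := (hp.pos w).le
            by_cases hw : R < ‖w‖
            · have : ({w : Fin n → ℝ | R < ‖w‖}.indicator p w) = p w :=
                Set.indicator_of_mem (s := {w : Fin n → ℝ | R < ‖w‖}) hw _
              simp only [this]
              have := mul_le_mul_of_nonneg_right (hgG (w + A e)) hpw
              linarith
            · have : ({w : Fin n → ℝ | R < ‖w‖}.indicator p w) = 0 :=
                Set.indicator_of_notMem (s := {w : Fin n → ℝ | R < ‖w‖}) hw _
              simp only [this]
              have hb : r ≤ ‖M ((A ^ k) (w + A e))‖ := by
                have e1 : M ((A ^ k) (w + A e)) = M ((A ^ (k + 1)) e) + (M.comp (A ^ k)) w := by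
                  rw [pow_succ]; simp [add_comm]
                have h3 : ‖(M.comp (A ^ k)) w‖ ≤ ‖M.comp (A ^ k)‖ * R :=
                  (ContinuousLinearMap.le_opNorm _ _).trans
                    (mul_le_mul_of_nonneg_left (not_lt.1 hw) (norm_nonneg _))
                rw [e1]
                have h4 := norm_sub_le_norm_add (M ((A ^ (k + 1)) e)) ((M.comp (A ^ k)) w)
                linarith
              have := mul_le_mul_of_nonneg_right (h g hg G hG1 hgG _ hb) hpw
              linarith
        _ = (G - 2 * (D + θ)) + 2 * (D + θ) * ∫ w in {w | R < ‖w‖}, p w := by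
            rw [integral_add i1 i2, integral_const_mul, integral_const_mul, hp.one,
              integral_indicator hms, mul_one]
        _ ≤ G - (D + θ) := by nlinarith
    refine (hg.le e).trans (max_le (by linarith) ?_)
    linarith

lemma local_bound (hp : NiceD p) (ρ : ℝ) : ∃ C : ℝ, 0 ≤ C ∧ ∀ (g : (Fin n → ℝ) → ℝ) (G : ℝ),
    Continuous g → (∀ x, 0 ≤ g x) → (∀ x, g x ≤ G) → ∀ x, ‖x‖ ≤ ρ →
    PP p g x ≤ C * PP p g 0 + G / 2 := by
  obtain ⟨R, hR0, hR⟩ := exists_tail hp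
  have hpc := hp.cont
  have cp : IsCompact ((Metric.closedBall (0 : Fin n → ℝ) R)) := isCompact_closedBall _ _
  have cp2 : IsCompact ((Metric.closedBall (0 : Fin n → ℝ) R) ×ˢ (Metric.closedBall (0 : Fin n → ℝ) ρ)) :=
    cp.prod (isCompact_closedBall _ _)
  have cq : ContinuousOn (fun z : (Fin n → ℝ) × (Fin n → ℝ) => p z.1 / p (z.1 + z.2))
      ((Metric.closedBall (0 : Fin n → ℝ) R) ×ˢ (Metric.closedBall (0 : Fin n → ℝ) ρ)) := by
    apply Continuous.continuousOn
    exact Continuous.div (by fun_prop) (by fun_prop) fun z => (hp.pos _).ne'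
  obtain ⟨C, hC⟩ := cp2.exists_bound_of_continuousOn cq
  refine ⟨max C 0, le_max_right _ _, fun g G hg h0 hG x hx => ?_⟩
  have habs : ∀ x, |g x| ≤ G := fun x => by rw [abs_of_nonneg (h0 x)]; exact hG x
  have hG0 : 0 ≤ G := (h0 0).trans (hG 0)
  have hms : MeasurableSet {w : Fin n → ℝ | R < ‖w‖} :=
      measurableSet_lt measurable_const measurable_norm
  have i0 : Integrable (fun y => g y * p y) := by simpa using PP_integrable hp hg habs 0
  have i1 : Integrable (fun w => max C 0 * (g (w + x) * p (w + x))) :=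
    (i0.comp_add_right x).const_mul _
  have i2 : Integrable (fun w => G * ({w : Fin n → ℝ | R < ‖w‖}.indicator p w)) :=
        (hp.int.indicator hms).const_mul _
  have e0 : PP p g 0 = ∫ w, g (w + x) * p (w + x) := by
    rw [integral_add_right_eq_self (fun y => g y * p y) x]; simp [PP]
  rw [PP_shift, e0]
  calc ∫ w, g (w + x) * p w
      ≤ ∫ w, (max C 0 * (g (w + x) * p (w + x)) + G * ({w : Fin n → ℝ | R < ‖w‖}.indicator p w)) := by
        refine integral_mono (PP_int_shift hp hg habs _) (i1.add i2) fun w => ?_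
        have hpw := (hp.pos w).le
        have hpw2 := (hp.pos (w + x)).le
        have hm : 0 ≤ max C 0 := le_max_right _ _
        have hgw := h0 (w + x)
        by_cases hw : R < ‖w‖
        · have : ({w : Fin n → ℝ | R < ‖w‖}.indicator p w) = p w :=
            Set.indicator_of_mem (s := {w : Fin n → ℝ | R < ‖w‖}) hw _
          simp only [this]
          have := mul_le_mul_of_nonneg_right (hG (w + x)) hpw
          have : 0 ≤ max C 0 * (g (w + x) * p (w + x)) := by positivity
          linarith
        · have : ({w : Fin n → ℝ | R < ‖w‖}.indicator p w) = 0 :=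
            Set.indicator_of_notMem (s := {w : Fin n → ℝ | R < ‖w‖}) hw _
          simp only [this]
          have h1 := hC (w, x) ⟨by simpa using not_lt.1 hw, by simpa using hx⟩
          have h2 : p w ≤ max C 0 * p (w + x) := by
            have h3 := (le_abs_self _).trans (h1.trans (le_max_left C 0))
            exact (div_le_iff₀ (hp.pos _)).1 h3
          have := mul_le_mul_of_nonneg_left h2 hgw
          linarith
    _ = max C 0 * (∫ w, g (w + x) * p (w + x)) + G * ∫ w in {w | R < ‖w‖}, p w := by
        rw [integral_add i1 i2, integral_const_mul, integral_const_mul, integral_indicator hms]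
    _ ≤ _ := by nlinarith

/-- Observability decomposition. -/
lemma obs (A M : (Fin n → ℝ) →L[ℝ] (Fin n → ℝ)) : ∃ (K : ℕ), ∀ r : ℝ, ∃ ρ : ℝ, ∀ e,
    (∀ k < K, ‖M ((A ^ k) e)‖ ≤ r) → ∃ e0, ‖e0‖ ≤ ρ ∧ ∀ k, M ((A ^ k) (e - e0)) = 0 := by
  let f : ℕ →o (Submodule ℝ (Fin n → ℝ))ᵒᵈ :=
    { toFun := fun K => OrderDual.toDual (⨅ k : Fin K, LinearMap.ker (M.comp (A ^ (k : ℕ))).toLinearMap)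
      monotone' := by
        intro a b hab
        rw [OrderDual.toDual_le_toDual]
        refine le_iInf fun k => ?_
        exact iInf_le (fun k : Fin b => LinearMap.ker (M.comp (A ^ (k : ℕ))).toLinearMap)
          ⟨k, k.2.trans_le hab⟩ }
  obtain ⟨K, hK⟩ := IsArtinian.monotone_stabilizes f
  refine ⟨K, fun r => ?_⟩
  have hker : ∀ u, (∀ k < K, M ((A ^ k) u) = 0) → ∀ k, M ((A ^ k) u) = 0 := by
    intro u hu k
    have h1 : u ∈ (⨅ k : Fin K, LinearMap.ker (M.comp (A ^ (k : ℕ))).toLinearMap) := by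
      rw [Submodule.mem_iInf]
      intro k
      exact hu k k.2
    have h2 : (⨅ k : Fin K, LinearMap.ker (M.comp (A ^ (k : ℕ))).toLinearMap) =
        (⨅ j : Fin (K + k + 1), LinearMap.ker (M.comp (A ^ (j : ℕ))).toLinearMap) :=
      hK (K + k + 1) (by omega)
    rw [h2, Submodule.mem_iInf] at h1
    exact h1 ⟨k, by omega⟩
  let Φ : (Fin n → ℝ) →ₗ[ℝ] (Fin K → (Fin n → ℝ)) :=
    LinearMap.pi fun k => (M.comp (A ^ (k : ℕ))).toLinearMap
  obtain ⟨ψ, hψ⟩ := LinearMap.exists_rightInverse_of_surjective Φ.rangeRestrict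
    (LinearMap.range_eq_top.2 Φ.surjective_rangeRestrict)
  obtain ⟨Ψ, hΨ⟩ := LinearMap.exists_extend ψ
  refine ⟨‖LinearMap.toContinuousLinearMap Ψ‖ * max r 0, fun e he => ⟨Ψ (Φ e), ?_, ?_⟩⟩
  · refine ((LinearMap.toContinuousLinearMap Ψ).le_opNorm (Φ e)).trans
      (mul_le_mul_of_nonneg_left ?_ (norm_nonneg _))
    rw [pi_norm_le_iff_of_nonneg (le_max_right _ _)]
    intro k
    exact (he k k.2).trans (le_max_left _ _)
  · apply hker
    intro k hk
    have h1 : Φ (Ψ (Φ e)) = Φ e := by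
      have h2 : Ψ (Φ e) = ψ (Φ.rangeRestrict e) := by
        rw [← hΨ]; rfl
      rw [h2]
      have := LinearMap.congr_fun hψ (Φ.rangeRestrict e)
      exact congrArg Subtype.val this
    have h3 := congrFun h1 ⟨k, hk⟩
    have h4 : M ((A ^ k) (Ψ (Φ e))) = M ((A ^ k) e) := h3
    rw [map_sub, map_sub, h4, sub_self]

lemma unif_bound (hp : NiceD p) {A M : (Fin n → ℝ) →L[ℝ] (Fin n → ℝ)} {c : (Fin n → ℝ) → ℝ}
    (hc : CostD A M c) {θ : ℝ} (hθ : 0 < θ) : ∃ G : ℝ, ∀ g, Adm p A M c θ g → ∀ x, g x ≤ G := by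
  obtain ⟨N, hN⟩ := obs A M
  choose r K hrK using fun k => claim hp hc hθ k 1 zero_le_one
  obtain ⟨r0, hr0⟩ : ∃ r0, ∀ k < N, r k ≤ r0 :=
    ⟨∑ k ∈ Finset.range N, |r k|, fun k hk => (le_abs_self _).trans
      (Finset.single_le_sum (f := fun k => |r k|) (fun i _ => abs_nonneg _) (Finset.mem_range.2 hk))⟩
  obtain ⟨K0, hK0⟩ : ∃ r0, ∀ k < N, K k ≤ r0 :=
    ⟨∑ k ∈ Finset.range N, |K k|, fun k hk => (le_abs_self _).trans
      (Finset.single_le_sum (f := fun k => |K k|) (fun i _ => abs_nonneg _) (Finset.mem_range.2 hk))⟩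
  obtain ⟨ρ, hρ⟩ := hN r0
  obtain ⟨C, hC0, hC⟩ := local_bound hp (‖A‖ * ρ)
  refine ⟨max K0 (2 * (θ + C * (2 * θ))), fun g hg => ?_⟩
  obtain ⟨C', hC'⟩ := hg.bdd
  have hbd : BddAbove (Set.range g) := ⟨C', by rintro _ ⟨x, rfl⟩; exact hC' x⟩
  set G := ⨆ x, g x with hGdef
  have hgG : ∀ x, g x ≤ G := fun x => le_ciSup hbd x
  suffices h : G ≤ max K0 (2 * (θ + C * (2 * θ))) from fun x => (hgG x).trans h
  by_contra hcon
  rw [not_le, max_lt_iff] at hcon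
  have hG0 : 0 ≤ G := (hg.nonneg 0).trans (hgG 0)
  have : ∀ x, g x ≤ max (G - 1) (θ + C * (2 * θ) + G / 2) := by
    intro e
    by_cases he : ∃ k < N, r k ≤ ‖M ((A ^ k) e)‖
    · obtain ⟨k, hk, hke⟩ := he
      exact (hrK k g hg G ((hK0 k hk).trans hcon.1.le) hgG e hke).trans (le_max_left _ _)
    · push Not at he
      obtain ⟨e0, he0, hinv⟩ := hρ e fun k hk => (he k hk).le.trans (hr0 k hk)
      have h1 : g e = g e0 := by
        have := hg.inv e0 (e - e0) hinv
        rwa [add_sub_cancel] at this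
      rw [h1]
      have h2 := hC g G hg.cont hg.nonneg hgG (A e0)
        ((A.le_opNorm e0).trans (mul_le_mul_of_nonneg_left he0 (norm_nonneg _)))
      have h3 := mul_le_mul_of_nonneg_left hg.zero hC0
      have hcn : 0 ≤ c e0 := (sq_nonneg _).trans (hc.lower e0)
      refine ((hg.le e0).trans (max_le (by positivity) ?_)).trans (le_max_right _ _)
      linarith
  have h5 : G ≤ max (G - 1) (θ + C * (2 * θ) + G / 2) := ciSup_le this
  rcases le_max_iff.1 h5 with h | h <;> linarith

end
section
variable {n : ℕ} {p : (Fin n → ℝ) → ℝ}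

lemma disc_exists (hp : NiceD p) {A M : (Fin n → ℝ) →L[ℝ] (Fin n → ℝ)} {c : (Fin n → ℝ) → ℝ}
    (hc : CostD A M c) {θ : ℝ} (hθ : 0 < θ) {α : ℝ} (h0 : 0 ≤ α) (h1 : α < 1) :
    ∃ V : (Fin n → ℝ) → ℝ, Continuous V ∧ (∃ C, ∀ x, |V x| ≤ C) ∧
      ∀ e, V e = min (θ + α * PP p V 0) (c e + α * PP p V (A e)) := by
  have hcn : ∀ e, 0 ≤ c e := fun e => (sq_nonneg _).trans (hc.lower e)
  have hb : ∀ V : BoundedContinuousFunction (Fin n → ℝ) ℝ, ∀ x, |V x| ≤ ‖V‖ :=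
    fun V x => V.norm_coe_le_norm x
  have hcc := hc.cont
  have hcont : ∀ V : BoundedContinuousFunction (Fin n → ℝ) ℝ,
      Continuous fun e => min (θ + α * PP p V 0) (c e + α * PP p V (A e)) := by
    intro V
    have := PP_continuous hp V.continuous (hb V)
    fun_prop
  have hbd : ∀ V : BoundedContinuousFunction (Fin n → ℝ) ℝ, ∀ e,
      ‖min (θ + α * PP p V 0) (c e + α * PP p V (A e))‖ ≤ θ + α * ‖V‖ := by
    intro V e
    have h2 := abs_le.1 (PP_abs_le hp V.continuous (hb V) 0)
    have h3 := abs_le.1 (PP_abs_le hp V.continuous (hb V) (A e))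
    have := hcn e
    rw [Real.norm_eq_abs, abs_le]
    constructor
    · refine le_min ?_ ?_ <;> nlinarith
    · refine (min_le_left _ _).trans ?_
      nlinarith
  let T : BoundedContinuousFunction (Fin n → ℝ) ℝ → BoundedContinuousFunction (Fin n → ℝ) ℝ :=
    fun V => BoundedContinuousFunction.ofNormedAddCommGroup _ (hcont V) _ (hbd V)
  have hT : ContractingWith ⟨α, h0⟩ T := by
    refine ⟨by exact_mod_cast h1, LipschitzWith.of_dist_le_mul fun V W => ?_⟩
    have hd : ∀ x, |PP p V x - PP p W x| ≤ dist V W := by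
      intro x
      have hh : ∀ y, |V y - W y| ≤ dist V W := fun y => V.dist_coe_le_dist y
      have a1 := PP_mono' hp V.continuous W.continuous (hb V) (hb W) (D := dist V W) (x := x)
        (x' := x) (fun w => by linarith [(abs_le.1 (hh (w + x))).2])
      have a2 := PP_mono' hp W.continuous V.continuous (hb W) (hb V) (D := dist V W) (x := x)
        (x' := x) (fun w => by linarith [(abs_le.1 (hh (w + x))).1])
      rw [abs_le]; constructor <;> linarith
    refine (BoundedContinuousFunction.dist_le (by positivity)).2 fun e => ?_
    change |min (θ + α * PP p V 0) (c e + α * PP p V (A e)) -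
      min (θ + α * PP p W 0) (c e + α * PP p W (A e))| ≤ α * dist V W
    refine (abs_min_sub_min_le_max _ _ _ _).trans (max_le ?_ ?_)
    · rw [add_sub_add_left_eq_sub, ← mul_sub, abs_mul, abs_of_nonneg h0]
      exact mul_le_mul_of_nonneg_left (hd _) h0
    · rw [add_sub_add_left_eq_sub, ← mul_sub, abs_mul, abs_of_nonneg h0]
      exact mul_le_mul_of_nonneg_left (hd _) h0
  have hfix := hT.fixedPoint_isFixedPt
  set V := ContractingWith.fixedPoint T hT
  refine ⟨V, V.continuous, ⟨_, hb V⟩, fun e => ?_⟩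
  exact (DFunLike.congr_fun hfix.symm e)

lemma disc_gain (hp : NiceD p) {A M : (Fin n → ℝ) →L[ℝ] (Fin n → ℝ)} {c : (Fin n → ℝ) → ℝ}
    (hc : CostD A M c) {θ : ℝ} (hθ : 0 < θ) {α : ℝ} (h0 : 1 / 2 ≤ α) (h1 : α < 1) :
    ∃ g : (Fin n → ℝ) → ℝ, Adm p A M c θ g ∧
      ∀ e, g e = max 0 (θ - α * PP p g 0 - c e + α * PP p g (A e)) := by
  have hα0 : 0 ≤ α := by linarith
  have hcn : ∀ e, 0 ≤ c e := fun e => (sq_nonneg _).trans (hc.lower e)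
  obtain ⟨V, hV, ⟨C, hC⟩, hVe⟩ := disc_exists hp hc hθ hα0 h1
  have hC0 : 0 ≤ C := (abs_nonneg _).trans (hC 0)
  have hlim : ∀ B : ℝ, Filter.Tendsto (fun k : ℕ => α ^ k * B) Filter.atTop (nhds 0) := by
    intro B
    simpa using (tendsto_pow_atTop_nhds_zero_of_lt_one hα0 h1).mul_const B
  have hVnn : ∀ e, 0 ≤ V e := by
    have key : ∀ k : ℕ, ∀ e, -(α ^ k * C) ≤ V e := by
      intro k
      induction k with
      | zero => intro e; simpa using (abs_le.1 (hC e)).1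
      | succ k ih =>
        intro e
        have hP : ∀ x, -(α ^ k * C) ≤ PP p V x := by
          intro x
          have := PP_mono' hp (f := fun _ => 0) (g := V) continuous_const hV (C := 0) (by simp) hC
            (D := α ^ k * C) (x := x) (x' := x) (fun w => by linarith [ih (w + x)])
          rw [PP_const hp] at this
          linarith
        have a1 := mul_le_mul_of_nonneg_left (hP 0) hα0
        have a2 := mul_le_mul_of_nonneg_left (hP (A e)) hα0
        rw [hVe e, pow_succ]
        have := hcn e
        refine le_min ?_ ?_ <;> nlinarith
    intro e
    have := (hlim C).neg
    rw [neg_zero] at this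
    exact le_of_tendsto' this fun k => key k e
  have hV0 : V 0 = α * PP p V 0 := by
    have := hVe 0
    rw [map_zero, hc.zero, zero_add, min_eq_right (by linarith)] at this
    exact this
  set v := V 0 with hv
  have hv0 : 0 ≤ v := hVnn 0
  have hgc : Continuous fun e => (θ + v) - V e := by fun_prop
  have hP : ∀ x, PP p (fun e => (θ + v) - V e) x = (θ + v) - PP p V x :=
    fun x => PP_const_sub hp hV hC _ x
  have heq : ∀ e, (θ + v) - V e = max 0 (θ - α * PP p (fun e => (θ + v) - V e) 0 - c e +
      α * PP p (fun e => (θ + v) - V e) (A e)) := by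
    intro e
    rw [hVe e, hP, hP, ← hV0]
    rw [← max_sub_sub_left (θ + v)]
    congr 1
    · ring
    · linear_combination (hV0)
  have hnn : ∀ e, 0 ≤ (θ + v) - V e := fun e => by rw [heq e]; exact le_max_left _ _
  refine ⟨_, ⟨hgc, hnn, ⟨θ + v, fun x => by linarith [hVnn x]⟩, ?_, ?_, ?_⟩, heq⟩
  · intro e
    rw [heq e]
    have a1 := PP_nonneg hp hnn 0
    have a2 := PP_nonneg hp hnn (A e)
    refine max_le_max le_rfl ?_
    nlinarith
  · have a1 := PP_nonneg hp hnn 0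
    rw [hP] at a1 ⊢
    nlinarith
  · intro x u hu
    have key : ∀ k : ℕ, ∀ u, (∀ k : ℕ, M ((A ^ k) u) = 0) → ∀ x, |V (x + u) - V x| ≤ α ^ k * (2 * C) := by
      intro k
      induction k with
      | zero =>
        intro u _ x
        rw [pow_zero, one_mul]
        have b1 := abs_le.1 (hC (x + u))
        have b2 := abs_le.1 (hC x)
        rw [abs_le]; constructor <;> linarith
      | succ k ih =>
        intro u hu x
        have hAu : ∀ k : ℕ, M ((A ^ k) (A u)) = 0 := by
          intro k
          have := hu (k + 1)
          rw [pow_succ] at this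
          exact this
        have hi := ih (A u) hAu
        have a1 := PP_mono' hp hV hV hC hC (D := α ^ k * (2 * C)) (x := A x + A u) (x' := A x)
          (fun w => by have := (abs_le.1 (hi (w + A x))).2; rw [← add_assoc]; linarith)
        have a2 := PP_mono' hp hV hV hC hC (D := α ^ k * (2 * C)) (x := A x) (x' := A x + A u)
          (fun w => by have := (abs_le.1 (hi (w + A x))).1; rw [← add_assoc]; linarith)
        have hMu : M u = 0 := by simpa using hu 0
        rw [hVe (x + u), hVe x, hc.inv x u hMu, map_add]
        refine (abs_min_sub_min_le_max _ _ _ _).trans (max_le ?_ ?_)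
        · rw [sub_self, abs_zero]; positivity
        · rw [add_sub_add_left_eq_sub, ← mul_sub, abs_mul, abs_of_nonneg hα0, pow_succ', mul_assoc]
          refine mul_le_mul_of_nonneg_left ?_ hα0
          rw [abs_le]; constructor <;> linarith
    have h3 : |V (x + u) - V x| ≤ 0 := ge_of_tendsto' (hlim (2 * C)) fun k => key k u hu x
    have h4 := abs_nonpos_iff.1 h3
    linarith

lemma limit_gain (hp : NiceD p) {A M : (Fin n → ℝ) →L[ℝ] (Fin n → ℝ)} {c : (Fin n → ℝ) → ℝ}
    (hc : CostD A M c) {θ : ℝ} (hθ : 0 < θ) :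
    ∃ g : (Fin n → ℝ) → ℝ, Continuous g ∧ (∃ C, ∀ x, |g x| ≤ C) ∧
      ∀ e, g e = max 0 (θ - PP p g 0 - c e + PP p g (A e)) := by
  obtain ⟨G, hG⟩ := unif_bound hp hc hθ
  let α : ℕ → ℝ := fun k => 1 - 1 / 2 / ((k : ℝ) + 1)
  have hα1 : ∀ k, α k < 1 := fun k => by
    have : 0 < 1 / 2 / ((k : ℝ) + 1) := by positivity
    simp only [α]; linarith
  have hα2 : ∀ k, 1 / 2 ≤ α k := fun k => by
    have : 1 / 2 / ((k : ℝ) + 1) ≤ 1 / 2 := div_le_self (by norm_num) (by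
      have : (0:ℝ) ≤ k := by positivity
      linarith)
    simp only [α]; linarith
  have hαt : Filter.Tendsto α Filter.atTop (nhds 1) := by
    have : Filter.Tendsto (fun k : ℕ => (1:ℝ) - 1 / 2 * (1 / ((k : ℝ) + 1))) Filter.atTop
        (nhds (1 - 1 / 2 * 0)) := (tendsto_one_div_add_atTop_nhds_zero_nat.const_mul _).const_sub _
    simp only [mul_zero, sub_zero] at this
    refine this.congr fun k => ?_
    simp only [α]; ring
  choose g hg heq using fun k => disc_gain hp hc hθ (hα2 k) (hα1 k)
  have hG' : ∀ k x, |g k x| ≤ G := fun k x => by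
    rw [abs_of_nonneg ((hg k).nonneg x)]; exact hG _ (hg k) x
  have hG0 : 0 ≤ G := (abs_nonneg _).trans (hG' 0 0)
  obtain ⟨φ, f, hφ, hfc, hf⟩ := extract (n := n) G (fun x y => G * L1mod p (A x) (A y) + |c x - c y|)
    (by
      intro x
      have t1 : Filter.Tendsto (fun y => G * L1mod p (A x) (A y)) (nhds x) (nhds (G * 0)) :=
        ((L1mod_tendsto hp (A x)).comp (A.continuous.tendsto x)).const_mul G
      have t2 : Filter.Tendsto (fun y => |c x - c y|) (nhds x) (nhds |c x - c x|) := by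
        have := hc.cont
        exact (by fun_prop : Continuous fun y => |c x - c y|).tendsto x
      simpa using t1.add t2)
    g (fun k x => ⟨(hg k).nonneg x, hG _ (hg k) x⟩) (by
      intro k x y
      rw [heq k x, heq k y]
      refine (abs_max_sub_max_le_max _ _ _ _).trans (max_le ?_ ?_)
      · have : 0 ≤ L1mod p (A x) (A y) := integral_nonneg fun _ => abs_nonneg _
        rw [sub_self, abs_zero]; positivity
      · have a1 := PP_modulus hp (hg k).cont (hG' k) (A x) (A y)
        have e1 : θ - α k * PP p (g k) 0 - c x + α k * PP p (g k) (A x) -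
          (θ - α k * PP p (g k) 0 - c y + α k * PP p (g k) (A y)) =
          α k * (PP p (g k) (A x) - PP p (g k) (A y)) - (c x - c y) := by ring
        rw [e1]
        refine (abs_sub _ _).trans (add_le_add ?_ le_rfl)
        have hk : 0 ≤ α k := by linarith [hα2 k]
        rw [abs_mul, abs_of_nonneg hk]
        refine le_trans ?_ a1
        exact mul_le_of_le_one_left (abs_nonneg _) (hα1 k).le)
  have hPt : ∀ x, Filter.Tendsto (fun k => PP p (g (φ k)) x) Filter.atTop (nhds (PP p f x)) := by
    intro x
    unfold PP
    refine tendsto_integral_of_dominated_convergence (fun y => G * p (y - x)) ?_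
      ((hp.int_shift x).const_mul G) ?_ ?_
    · intro k
      exact (PP_integrable hp (hg _).cont (hG' _) x).aestronglyMeasurable
    · intro k
      refine Filter.Eventually.of_forall fun y => ?_
      rw [norm_mul, Real.norm_eq_abs, Real.norm_eq_abs, abs_of_nonneg (hp.pos _).le]
      exact mul_le_mul_of_nonneg_right (hG' _ _) (hp.pos _).le
    · exact Filter.Eventually.of_forall fun y => (hf y).mul_const _
  refine ⟨f, hfc, ⟨G, fun x => le_of_tendsto' (hf x).abs fun k => hG' _ _⟩, fun e => ?_⟩
  refine tendsto_nhds_unique (hf e) ?_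
  have hα' := hαt.comp hφ.tendsto_atTop
  have t : Filter.Tendsto (fun k => max 0 (θ - α (φ k) * PP p (g (φ k)) 0 - c e +
      α (φ k) * PP p (g (φ k)) (A e))) Filter.atTop
      (nhds (max 0 (θ - 1 * PP p f 0 - c e + 1 * PP p f (A e)))) := by
    refine Filter.Tendsto.max tendsto_const_nhds ?_
    exact (((hα'.mul (hPt 0)).const_sub θ).sub_const (c e)).add (hα'.mul (hPt (A e)))
  simp only [one_mul] at t
  exact t.congr fun k => (heq _ e).symm

lemma final_abs (hp : NiceD p) {A M : (Fin n → ℝ) →L[ℝ] (Fin n → ℝ)} {c : (Fin n → ℝ) → ℝ}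
    (hc : CostD A M c) {θ : ℝ} (hθ : 0 < θ) :
    ∃ (j : ℝ) (h : (Fin n → ℝ) → ℝ), Continuous h ∧ (∃ C, ∀ x, |h x| ≤ C) ∧ h 0 = 0 ∧
      ∀ e, j + h e = min (θ + PP p h 0) (c e + PP p h (A e)) := by
  obtain ⟨g, hg, ⟨C, hC⟩, heq⟩ := limit_gain hp hc hθ
  have hP : ∀ x, PP p (fun e => θ - g e) x = θ - PP p g x := fun x => PP_const_sub hp hg hC _ x
  refine ⟨θ - PP p g 0, fun e => θ - g e, by fun_prop, ⟨θ + C, fun x => ?_⟩, ?_, fun e => ?_⟩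
  · have := abs_le.1 (hC x)
    rw [abs_le]; constructor <;> linarith
  · have := heq 0
    rw [map_zero, hc.zero, max_eq_right (by linarith)] at this
    simp only
    linarith
  · rw [hP, hP]
    simp only
    rw [heq e, ← add_sub_assoc, ← min_sub_sub_left]
    congr 1 <;> ring

end
section
variable {n : ℕ}

open scoped MatrixOrder Matrix.Norms.L2Operator in
lemma psd_factor {S : Matrix (Fin n) (Fin n) ℝ} (hS : S.PosSemidef) :
    ∃ B : Matrix (Fin n) (Fin n) ℝ, S = Bᵀ * B := by
  obtain ⟨B, hB⟩ := CStarAlgebra.nonneg_iff_eq_star_mul_self.mp hS.nonneg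
  exact ⟨B, by rw [hB, star_eq_conjTranspose, conjTranspose_eq_transpose_of_trivial]⟩

lemma quad_factor (B : Matrix (Fin n) (Fin n) ℝ) (x : Fin n → ℝ) :
    x ⬝ᵥ (Bᵀ * B).mulVec x = B.mulVec x ⬝ᵥ B.mulVec x := by
  rw [← mulVec_mulVec, dotProduct_mulVec, vecMul_transpose]

lemma gauss_int (B : Matrix (Fin n) (Fin n) ℝ) (hB : B.det ≠ 0) :
    ∫ y : Fin n → ℝ, Real.exp (-(1 / 2) * (B.mulVec y ⬝ᵥ B.mulVec y)) =
      |B.det|⁻¹ * (2 * Real.pi) ^ ((n : ℝ) / 2) := by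
  have h1 : ∫ y : Fin n → ℝ, Real.exp (-(1 / 2) * (y ⬝ᵥ y)) = (2 * Real.pi) ^ ((n : ℝ) / 2) := by
    have : ∀ y : Fin n → ℝ, Real.exp (-(1 / 2) * (y ⬝ᵥ y)) = ∏ i, Real.exp (-(1 / 2) * (y i) ^ 2) := by
      intro y
      rw [← Real.exp_sum, dotProduct, Finset.mul_sum]
      simp only [sq]
    simp_rw [this]
    rw [integral_fintype_prod_volume_eq_pow (fun t : ℝ => Real.exp (-(1 / 2) * t ^ 2)),
      integral_gaussian, Fintype.card_fin]
    rw [show Real.pi / (1 / 2) = 2 * Real.pi by ring, Real.sqrt_eq_rpow, ← Real.rpow_natCast,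
      ← Real.rpow_mul (by positivity)]
    congr 1; ring
  have h2 := Real.map_matrix_volume_pi_eq_smul_volume_pi hB
  have h3 : ∫ y, Real.exp (-(1 / 2) * (y ⬝ᵥ y)) ∂(Measure.map (toLin' B) volume) =
      ∫ y : Fin n → ℝ, Real.exp (-(1 / 2) * (B.mulVec y ⬝ᵥ B.mulVec y)) := by
    rw [integral_map]
    · rfl
    · exact (LinearMap.continuous_of_finiteDimensional (toLin' B)).measurable.aemeasurable
    · refine Continuous.aestronglyMeasurable ?_
      simp only [dotProduct]
      fun_prop
  rw [← h3, h2, integral_smul_measure, h1, ENNReal.toReal_ofReal (abs_nonneg _), abs_inv, smul_eq_mul]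

lemma gauss_nice {Ξ : Matrix (Fin n) (Fin n) ℝ} (hΞ : Ξ.PosDef) : NiceD (gaussDensity n Ξ) := by
  have hd := hΞ.det_pos
  obtain ⟨B, hB⟩ := psd_factor hΞ.inv.posSemidef
  have hdet : B.det * B.det = Ξ.det⁻¹ := by
    have := congrArg Matrix.det hB
    rw [det_mul, det_transpose, det_nonsing_inv, Ring.inverse_eq_inv'] at this
    exact this.symm
  have hB0 : B.det ≠ 0 := by
    intro h
    rw [h, mul_zero] at hdet
    exact (inv_pos.2 hd).ne hdet
  have he : gaussDensity n Ξ = fun y => (2 * Real.pi) ^ (-(n : ℝ) / 2) * Ξ.det ^ (-(1 : ℝ) / 2) *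
    Real.exp (-(1 / 2) * (B.mulVec y ⬝ᵥ B.mulVec y)) := by
    ext y
    rw [gaussDensity, hB, quad_factor]
  have hone : ∫ x, gaussDensity n Ξ x = 1 := by
    rw [he, integral_const_mul, gauss_int B hB0]
    have e1 : Ξ.det ^ (-(1 : ℝ) / 2) = |B.det| := by
      rw [neg_div, Real.rpow_neg hd.le, ← Real.sqrt_eq_rpow, ← Real.sqrt_inv, ← hdet,
        Real.sqrt_mul_self_eq_abs]
    have e2 : (2 * Real.pi) ^ (-(n : ℝ) / 2) * (2 * Real.pi) ^ ((n : ℝ) / 2) = 1 := by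
      rw [← Real.rpow_add (by positivity)]
      rw [show -(n : ℝ) / 2 + n / 2 = 0 by ring, Real.rpow_zero]
    rw [e1]
    have h3 : |B.det| * |B.det|⁻¹ = 1 := mul_inv_cancel₀ (abs_ne_zero.2 hB0)
    linear_combination |B.det| * |B.det|⁻¹ * e2 + h3
  refine ⟨?_, fun x => ?_, ?_, hone⟩
  · unfold gaussDensity
    simp only [dotProduct, mulVec]
    fun_prop
  · unfold gaussDensity; positivity
  · by_contra h
    rw [integral_undef h] at hone
    norm_num at hone

end

/-- Existence of a solution to the average-cost Bellman optimality equation. -/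
theorem bellman_solution_exists
    (n : ℕ) (hn : 1 ≤ n) (A S Ξ : Matrix (Fin n) (Fin n) ℝ)
    (hS : S.PosSemidef) (hΞ : Ξ.PosDef) (θ : ℝ) (hθ : 0 < θ) :
    ∃ (jstar : ℝ) (h : (Fin n → ℝ) → ℝ),
      Continuous h ∧ (∃ C : ℝ, ∀ e, |h e| ≤ C) ∧ h 0 = 0 ∧
      ∀ e : Fin n → ℝ,
        jstar + h e =
          min (θ + ∫ y : Fin n → ℝ, h y * gaussDensity n Ξ y)
            (e ⬝ᵥ (Aᵀ * S * A).mulVec e +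
              ∫ y : Fin n → ℝ, h y * gaussDensity n Ξ (y - A.mulVec e)) := by
  obtain ⟨B, hB⟩ := psd_factor hS
  have hq : ∀ e : Fin n → ℝ, e ⬝ᵥ (Aᵀ * S * A).mulVec e =
      (B * A).mulVec e ⬝ᵥ (B * A).mulVec e := by
    intro e
    rw [← quad_factor, hB, transpose_mul]
    simp only [Matrix.mul_assoc]
  have hc : CostD (LinearMap.toContinuousLinearMap (toLin' A))
      (LinearMap.toContinuousLinearMap (toLin' (B * A)))
      (fun e => e ⬝ᵥ (Aᵀ * S * A).mulVec e) := by
    refine ⟨?_, by simp, fun x => ?_, fun x u hu => ?_⟩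
    · simp only [dotProduct, mulVec]
      fun_prop
    · rw [hq]
      change ‖(B * A).mulVec x‖ ^ 2 ≤ _
      set v := (B * A).mulVec x
      have hv : 0 ≤ v ⬝ᵥ v := Finset.sum_nonneg fun i _ => mul_self_nonneg _
      have : ‖v‖ ≤ Real.sqrt (v ⬝ᵥ v) := by
        rw [pi_norm_le_iff_of_nonneg (Real.sqrt_nonneg _)]
        intro i
        apply Real.le_sqrt_of_sq_le
        rw [Real.norm_eq_abs, sq_abs, sq]
        exact Finset.single_le_sum (f := fun i => v i * v i) (fun i _ => mul_self_nonneg _)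
          (Finset.mem_univ i)
      calc ‖v‖ ^ 2 ≤ Real.sqrt (v ⬝ᵥ v) ^ 2 := by gcongr
        _ = _ := Real.sq_sqrt hv
    · have hu' : (B * A).mulVec u = 0 := hu
      simp only [hq]
      rw [mulVec_add, hu', add_zero]
  obtain ⟨j, h, h1, h2, h3, h4⟩ := final_abs (gauss_nice hΞ) hc hθ
  refine ⟨j, h, h1, h2, h3, fun e => ?_⟩
  have := h4 e
  simp only [PP, sub_zero] at this
  exact this
end

section
/- Upper bound on the differential cost (equation (h bound) in the proof of Theorem 2): if j* ∈ ℝ and a bounded measurable function h : ℝⁿ → ℝ with h(0) = 0 satisfy the average-cost Bellman equation, namely j* + h(e) = min( θ + ∫_{ℝⁿ} h(y) p_Ξ(y) dy , eᵀAᵀΣA e + ∫_{ℝⁿ} h(y) p_Ξ(y − A e) dy ) for every e ∈ ℝⁿ, then h(e) ≤ θ for every e ∈ ℝⁿ. -/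
open MeasureTheory Matrix

/-- Upper bound on the differential cost: a solution of the average-cost Bellman equation
with `h 0 = 0` satisfies `h(e) ≤ θ` for every `e`. -/
theorem differential_cost_upper_bound
    (n : ℕ) (hn : 1 ≤ n) (A S Ξ : Matrix (Fin n) (Fin n) ℝ)
    (hS : S.PosSemidef) (hΞ : Ξ.PosDef) (θ : ℝ) (hθ : 0 < θ)
    (jstar : ℝ) (h : (Fin n → ℝ) → ℝ)
    (hmeas : Measurable h) (hbdd : ∃ C : ℝ, ∀ e, |h e| ≤ C) (h0 : h 0 = 0)
    (hbellman : ∀ e : Fin n → ℝ,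
      jstar + h e =
        min (θ + ∫ y : Fin n → ℝ, h y * gaussDensity n Ξ y)
          (e ⬝ᵥ (Aᵀ * S * A).mulVec e +
            ∫ y : Fin n → ℝ, h y * gaussDensity n Ξ (y - A.mulVec e))) :
    ∀ e : Fin n → ℝ, h e ≤ θ := by
  intro e
  have h1 := hbellman 0
  simp only [h0, Matrix.mulVec_zero, sub_zero, zero_dotProduct, zero_add, add_zero] at h1
  rw [min_eq_right (by linarith)] at h1
  have h2 := (hbellman e).le.trans (min_le_left _ _)
  linarith
end

section
/- Boundedness of the non-transmission region (key step in the proof of Theorem 2): let N ≥ 0 and let h : ℝⁿ → ℝ be a measurable function with −N ≤ h(y) ≤ θ for all y ∈ ℝⁿ. Define VoI(e) = eᵀAᵀΣA e + ∫_{ℝⁿ} h(y) p_Ξ(y − A e) dy − θ − ∫_{ℝⁿ} h(y) p_Ξ(y) dy. Then VoI(e) < 0 implies eᵀAᵀΣA e < 2θ + N. In particular, if A is invertible and Σ is positive definite, the set {e ∈ ℝⁿ : VoI(e) < 0} is bounded. -/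
open MeasureTheory Matrix

open scoped MatrixOrder in
lemma posDef_factor {n : ℕ} {M : Matrix (Fin n) (Fin n) ℝ} (hM : M.PosDef) :
    ∃ B : Matrix (Fin n) (Fin n) ℝ, B.det ≠ 0 ∧ M.det = B.det ^ 2 ∧
      ∀ y : Fin n → ℝ, y ⬝ᵥ M.mulVec y = ∑ i, (B.mulVec y i) ^ 2 := by
  obtain ⟨B, hB⟩ := CStarAlgebra.nonneg_iff_eq_star_mul_self.mp hM.posSemidef.nonneg
  have hB' : M = Bᵀ * B := by
    rw [hB, star_eq_conjTranspose, conjTranspose_eq_transpose_of_trivial]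
  have hd : M.det = B.det ^ 2 := by rw [hB', det_mul, det_transpose, sq]
  refine ⟨B, ?_, hd, ?_⟩
  · intro h0
    have := hM.det_pos
    rw [hd, h0] at this
    simp at this
  · intro y
    rw [hB', ← mulVec_mulVec, dotProduct_mulVec, vecMul_transpose]
    simp [dotProduct, sq]

lemma std_integrable (n : ℕ) :
    Integrable (fun z : Fin n → ℝ => ∏ i, Real.exp (-(1 / 2) * (z i) ^ 2)) := by
  apply Integrable.fintype_prod (f := fun (_ : Fin n) (v : ℝ) => Real.exp (-(1 / 2) * v ^ 2))
  intro i
  exact integrable_exp_neg_mul_sq (by norm_num)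

lemma std_integral (n : ℕ) :
    ∫ z : Fin n → ℝ, ∏ i, Real.exp (-(1 / 2) * (z i) ^ 2) = (2 * Real.pi) ^ ((n : ℝ) / 2) := by
  rw [integral_fintype_prod_volume_eq_pow (fun v : ℝ => Real.exp (-(1 / 2) * v ^ 2)),
    integral_gaussian, Fintype.card_fin, Real.sqrt_eq_rpow, ← Real.rpow_natCast,
    ← Real.rpow_mul (by positivity)]
  congr 1 <;> ring

lemma gauss_facts (n : ℕ) (Ξ : Matrix (Fin n) (Fin n) ℝ) (hΞ : Ξ.PosDef) :
    Integrable (gaussDensity n Ξ) ∧ ∫ y, gaussDensity n Ξ y = 1 := by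
  obtain ⟨B, hB0, hBd, hB⟩ := posDef_factor hΞ.inv
  set g : (Fin n → ℝ) → ℝ := fun z => ∏ i, Real.exp (-(1 / 2) * (z i) ^ 2) with hg
  set c : ℝ := (2 * Real.pi) ^ (-(n : ℝ) / 2) * Ξ.det ^ (-(1 : ℝ) / 2) with hc
  have hform : gaussDensity n Ξ = fun y => c * g (toLin' B y) := by
    funext y
    simp only [gaussDensity, hB, hg, ← Real.exp_sum, ← Finset.mul_sum, toLin'_apply, hc]
  have hmap := Real.map_matrix_volume_pi_eq_smul_volume_pi hB0
  have hcont : Continuous (toLin' B) := LinearMap.continuous_on_pi _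
  have hgc : Continuous g := by fun_prop
  have hi : Integrable g (Measure.map (toLin' B) volume) := by
    rw [hmap]
    exact (std_integrable n).smul_measure ENNReal.ofReal_ne_top
  have hdet : Ξ.det ^ (-(1 : ℝ) / 2) = |B.det| := by
    have hp := hΞ.det_pos
    have : Ξ.det⁻¹ = B.det ^ 2 := by
      rw [← hBd, det_nonsing_inv, Ring.inverse_eq_inv']
    rw [← Real.sqrt_sq_eq_abs, ← this, Real.sqrt_eq_rpow, Real.inv_rpow hp.le,
      ← Real.rpow_neg hp.le]
    congr 1; ring
  constructor
  · rw [hform]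
    exact (hi.comp_measurable hcont.measurable).const_mul c
  · rw [hform, integral_const_mul,
      ← integral_map hcont.measurable.aemeasurable hgc.aestronglyMeasurable, hmap,
      integral_smul_measure, std_integral, hc, hdet, ENNReal.toReal_ofReal (abs_nonneg _),
      abs_inv, smul_eq_mul, neg_div, Real.rpow_neg (by positivity)]
    have h1 : |B.det| ≠ 0 := abs_ne_zero.mpr hB0
    have h2 : (2 * Real.pi) ^ ((n : ℝ) / 2) ≠ 0 := by positivity
    field_simp

lemma gauss_nonneg (n : ℕ) (Ξ : Matrix (Fin n) (Fin n) ℝ) (hΞ : Ξ.PosDef) (y : Fin n → ℝ) :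
    0 ≤ gaussDensity n Ξ y := by
  have := hΞ.det_pos
  unfold gaussDensity
  positivity

lemma weighted_bounds {n : ℕ} (p h : (Fin n → ℝ) → ℝ) (hp : ∀ y, 0 ≤ p y) (hi : Integrable p)
    (h1 : ∫ y, p y = 1) (N θ : ℝ) (hmeas : Measurable h)
    (hb : ∀ y, -N ≤ h y ∧ h y ≤ θ) :
    -N ≤ ∫ y, h y * p y ∧ ∫ y, h y * p y ≤ θ := by
  have hint : Integrable (fun y => h y * p y) := by
    refine hi.bdd_mul (c := max N θ) hmeas.aestronglyMeasurable (.of_forall fun y => ?_)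
    rw [Real.norm_eq_abs, abs_le]
    exact ⟨by linarith [(hb y).1, le_max_left N θ], (hb y).2.trans (le_max_right _ _)⟩
  constructor
  · calc -N = ∫ y, -N * p y := by rw [integral_const_mul, h1, mul_one]
      _ ≤ _ := integral_mono (hi.const_mul _) hint
        fun y => mul_le_mul_of_nonneg_right (hb y).1 (hp y)
  · calc ∫ y, h y * p y ≤ ∫ y, θ * p y := integral_mono hint (hi.const_mul _)
          (fun y => mul_le_mul_of_nonneg_right (hb y).2 (hp y))
      _ = θ := by rw [integral_const_mul, h1, mul_one]

lemma bounded_sublevel {n : ℕ} {M : Matrix (Fin n) (Fin n) ℝ} (hM : M.PosDef) (K : ℝ) :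
    Bornology.IsBounded {e : Fin n → ℝ | e ⬝ᵥ M.mulVec e < K} := by
  obtain ⟨C, hC0, -, hC⟩ := posDef_factor hM
  have hcont : Continuous (toLin' C⁻¹) := LinearMap.continuous_on_pi _
  refine (((isCompact_closedBall (0 : Fin n → ℝ) (√K)).image hcont).isBounded).subset ?_
  intro e he
  rw [Set.mem_setOf_eq, hC] at he
  refine ⟨C.mulVec e, ?_, ?_⟩
  · rw [mem_closedBall_zero_iff, pi_norm_le_iff_of_nonneg (Real.sqrt_nonneg _)]
    intro i
    rw [Real.norm_eq_abs]
    apply Real.abs_le_sqrt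
    exact (Finset.single_le_sum (f := fun i => (C.mulVec e i) ^ 2)
      (fun _ _ => sq_nonneg _) (Finset.mem_univ i)).trans he.le
  · rw [toLin'_apply, mulVec_mulVec, nonsing_inv_mul _ (isUnit_iff_ne_zero.mpr hC0), one_mulVec]

/-- Boundedness of the non-transmission region: if `-N ≤ h ≤ θ`, then `VoI(e) < 0` implies
`eᵀAᵀΣAe < 2θ + N`; in particular, when `A` is invertible and `Σ` is positive definite, the
non-transmission region `{e : VoI e < 0}` is bounded. -/
theorem nontransmission_region_bounded
    (n : ℕ) (hn : 1 ≤ n) (A S Ξ : Matrix (Fin n) (Fin n) ℝ)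
    (hS : S.PosSemidef) (hΞ : Ξ.PosDef) (θ : ℝ) (hθ : 0 < θ)
    (N : ℝ) (hN : 0 ≤ N) (h : (Fin n → ℝ) → ℝ) (hmeas : Measurable h)
    (hbound : ∀ y : Fin n → ℝ, -N ≤ h y ∧ h y ≤ θ)
    (VoI : (Fin n → ℝ) → ℝ)
    (hVoI : ∀ e : Fin n → ℝ,
      VoI e = e ⬝ᵥ (Aᵀ * S * A).mulVec e +
        (∫ y : Fin n → ℝ, h y * gaussDensity n Ξ (y - A.mulVec e)) - θ -
        ∫ y : Fin n → ℝ, h y * gaussDensity n Ξ y) :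
    (∀ e : Fin n → ℝ, VoI e < 0 → e ⬝ᵥ (Aᵀ * S * A).mulVec e < 2 * θ + N) ∧
    (IsUnit A.det → S.PosDef → Bornology.IsBounded {e : Fin n → ℝ | VoI e < 0}) := by
  obtain ⟨hi, h1⟩ := gauss_facts n Ξ hΞ
  have key : ∀ e : Fin n → ℝ, VoI e < 0 → e ⬝ᵥ (Aᵀ * S * A).mulVec e < 2 * θ + N := by
    intro e he
    rw [hVoI] at he
    have b0 := weighted_bounds (gaussDensity n Ξ) h (gauss_nonneg n Ξ hΞ) hi h1 N θ hmeas hbound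
    have b1 := weighted_bounds (fun y => gaussDensity n Ξ (y - A.mulVec e)) h
      (fun y => gauss_nonneg n Ξ hΞ _) (hi.comp_sub_right _)
      (by rw [integral_sub_right_eq_self (gaussDensity n Ξ), h1]) N θ hmeas hbound
    have := b0.2
    have := b1.1
    linarith
  refine ⟨key, fun hA hSd => ?_⟩
  have hM : (Aᵀ * S * A).PosDef := by
    have := hSd.conjTranspose_mul_mul_same (B := A)
      (mulVec_injective_iff_isUnit.mpr ((isUnit_iff_isUnit_det A).mpr hA))
    rwa [conjTranspose_eq_transpose_of_trivial] at this
  exact (bounded_sublevel hM (2 * θ + N)).subset fun e he => key e he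
end

section
/- Symmetry of the value-iteration functions (Proposition 3): define J_0 ≡ 0 and, for t ≥ 0, J_{t+1}(e) = min( θ + ∫_{ℝⁿ} J_t(y) p_Ξ(y) dy , eᵀAᵀΣA e + ∫_{ℝⁿ} J_t(y) p_Ξ(y − A e) dy ). Then for every t ≥ 0 and every e ∈ ℝⁿ, J_t(−e) = J_t(e). -/
open MeasureTheory Matrix

/-- The value iteration sequence: `J_0 ≡ 0` and
`J_{t+1}(e) = min(θ + ∫ J_t(y) p_Ξ(y) dy, eᵀAᵀΣAe + ∫ J_t(y) p_Ξ(y - Ae) dy)`. -/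
noncomputable def valueIter (n : ℕ) (A S Ξ : Matrix (Fin n) (Fin n) ℝ) (θ : ℝ) :
    ℕ → (Fin n → ℝ) → ℝ
  | 0 => fun _ => 0
  | t + 1 => fun e =>
      min (θ + ∫ y : Fin n → ℝ, valueIter n A S Ξ θ t y * gaussDensity n Ξ y)
        (e ⬝ᵥ (Aᵀ * S * A).mulVec e +
          ∫ y : Fin n → ℝ, valueIter n A S Ξ θ t y * gaussDensity n Ξ (y - A.mulVec e))

theorem gaussDensity_neg' (n : ℕ) (Ξ : Matrix (Fin n) (Fin n) ℝ) (y : Fin n → ℝ) :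
    gaussDensity n Ξ (-y) = gaussDensity n Ξ y := by
  simp [gaussDensity, Matrix.mulVec_neg]

/-- Symmetry of the value-iteration functions: `J_t(-e) = J_t(e)` for every `t` and `e`. -/
theorem valueIter_even
    (n : ℕ) (hn : 1 ≤ n) (A S Ξ : Matrix (Fin n) (Fin n) ℝ)
    (hS : S.PosSemidef) (hΞ : Ξ.PosDef) (θ : ℝ) (hθ : 0 < θ) :
    ∀ (t : ℕ) (e : Fin n → ℝ), valueIter n A S Ξ θ t (-e) = valueIter n A S Ξ θ t e := by
  intro t
  induction t with
  | zero => intro e; simp [valueIter]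
  | succ t ih =>
    intro e
    have key : ∫ y : Fin n → ℝ, valueIter n A S Ξ θ t y * gaussDensity n Ξ (y - A.mulVec (-e))
        = ∫ y : Fin n → ℝ, valueIter n A S Ξ θ t y * gaussDensity n Ξ (y - A.mulVec e) := by
      rw [← integral_neg_eq_self
        (fun y => valueIter n A S Ξ θ t y * gaussDensity n Ξ (y - A.mulVec (-e)))]
      congr 1
      funext y
      rw [ih y, ← gaussDensity_neg' n Ξ (y - A.mulVec e), Matrix.mulVec_neg]
      congr 2
      abel
    simp only [valueIter]
    rw [key, Matrix.mulVec_neg, neg_dotProduct_neg]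
end

section
/- Monotonicity of the smoothed cost (Lemma 4): let p : ℝⁿ → [0,∞) be a measurable probability density (∫p = 1) that is even and coordinatewise unimodal, let h : ℝⁿ → ℝ be bounded, measurable, even, and coordinatewise nondecreasing in absolute value, and let Λ be a diagonal real n×n matrix. Then the function g(s) = ∫_{ℝⁿ} h(Λs + z) p(z) dz is even and coordinatewise nondecreasing in absolute value. -/
open MeasureTheory Matrix

/-- A function `f : ℝⁿ → ℝ` is even. -/
def IsEvenFun (n : ℕ) (f : (Fin n → ℝ) → ℝ) : Prop := ∀ x, f (-x) = f x

/-- `f : ℝⁿ → ℝ` is coordinatewise nondecreasing in absolute value. -/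
def CoordNondecAbs (n : ℕ) (f : (Fin n → ℝ) → ℝ) : Prop :=
  ∀ (i : Fin n) (u v : Fin n → ℝ), (∀ j, j ≠ i → u j = v j) → |u i| ≤ |v i| → f u ≤ f v

/-- `p : ℝⁿ → ℝ` is coordinatewise unimodal. -/
def CoordUnimodal (n : ℕ) (p : (Fin n → ℝ) → ℝ) : Prop :=
  ∀ (i : Fin n) (u v : Fin n → ℝ), (∀ j, j ≠ i → u j = v j) → |u i| ≤ |v i| → p v ≤ p u

theorem refl_mp (n : ℕ) (i : Fin n) (c : ℝ) :
    MeasurePreserving (fun (w : Fin n → ℝ) (j : Fin n) => if j = i then c - w j else w j)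
      volume volume := by
  have := volume_preserving_pi (ι := Fin n) (α' := fun _ => ℝ) (β' := fun _ => ℝ)
    (f := fun j x => if j = i then c - x else x) (fun j => by
      by_cases hj : j = i
      · simp only [hj, if_true]
        exact Measure.measurePreserving_sub_left volume c
      · simp only [hj, if_false]
        exact MeasurePreserving.id volume)
  exact this

theorem key_mono
    (n : ℕ) (p : (Fin n → ℝ) → ℝ)
    (hpmeas : Measurable p) (hpi : Integrable p)
    (hpuni : CoordUnimodal n p)
    (h : (Fin n → ℝ) → ℝ) (hmeas : Measurable h)
    (C : ℝ) (hC : ∀ y, |h y| ≤ C)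
    (hmono : CoordNondecAbs n h) :
    CoordNondecAbs n (fun a => ∫ z : Fin n → ℝ, h (a + z) * p z) := by
  intro i a b hab hle
  have hG : ∀ a : Fin n → ℝ, ∫ z, h (a + z) * p z = ∫ w, h w * p (w - a) := by
    intro a
    have := integral_add_left_eq_self (μ := (volume : Measure (Fin n → ℝ)))
      (fun w => h w * p (w - a)) a
    simpa using this
  simp only [hG]
  set T : (Fin n → ℝ) → (Fin n → ℝ) := fun w j => if j = i then a i + b i - w j else w j with hTdef
  have hT : MeasurePreserving T volume volume := refl_mp n i (a i + b i)
  have hcomp : ∀ f : (Fin n → ℝ) → ℝ, Measurable f → ∫ w, f (T w) = ∫ w, f w := by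
    intro f hf
    conv_rhs => rw [← hT.map_eq]
    rw [integral_map hT.measurable.aemeasurable hf.aestronglyMeasurable]
  have hTi : ∀ w, T w i = a i + b i - w i := fun w => by simp [hTdef]
  have hTj : ∀ w j, j ≠ i → T w j = w j := fun w j hj => by simp [hTdef, hj]
  have p1 : ∀ w, p (T w - b) = p (w - a) := by
    intro w
    have e : |(T w - b) i| = |(w - a) i| := by
      simp only [Pi.sub_apply, hTi]
      rw [← abs_neg]; congr 1; ring
    have e2 : ∀ j, j ≠ i → (T w - b) j = (w - a) j := by
      intro j hj
      simp [hTj w j hj, hab j hj]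
    exact le_antisymm (hpuni i _ _ (fun j hj => (e2 j hj).symm) e.ge) (hpuni i _ _ e2 e.le)
  have p2 : ∀ w, p (T w - a) = p (w - b) := by
    intro w
    have e : |(T w - a) i| = |(w - b) i| := by
      simp only [Pi.sub_apply, hTi]
      rw [← abs_neg]; congr 1; ring
    have e2 : ∀ j, j ≠ i → (T w - a) j = (w - b) j := by
      intro j hj
      simp [hTj w j hj, hab j hj]
    exact le_antisymm (hpuni i _ _ (fun j hj => (e2 j hj).symm) e.ge) (hpuni i _ _ e2 e.le)
  have hm : ∀ c : Fin n → ℝ, Measurable (fun w => h w * p (w - c)) := by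
    intro c
    exact hmeas.mul (hpmeas.comp (measurable_id.sub_const c))
  have q1 : ∫ w, h (T w) * p (w - a) = ∫ w, h w * p (w - b) := by
    rw [← hcomp _ (hm b)]; simp only [p1]
  have q2 : ∫ w, h (T w) * p (w - b) = ∫ w, h w * p (w - a) := by
    rw [← hcomp _ (hm a)]; simp only [p2]
  have hi : ∀ c : Fin n → ℝ, Integrable (fun w => h w * p (w - c)) := fun c =>
    (hpi.comp_sub_right c).bdd_mul (c := C) hmeas.aestronglyMeasurable
      (Filter.Eventually.of_forall hC)
  have hi' : ∀ c : Fin n → ℝ, Integrable (fun w => h (T w) * p (w - c)) := fun c =>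
    (hpi.comp_sub_right c).bdd_mul (c := C) (hmeas.comp hT.measurable).aestronglyMeasurable
      (Filter.Eventually.of_forall fun w => hC _)
  have hpos : 0 ≤ ∫ w, ((h w * p (w - b) - h w * p (w - a)) -
      (h (T w) * p (w - b) - h (T w) * p (w - a))) := by
    apply integral_nonneg
    intro w
    have hX : ((w i)^2 - (T w i)^2) * ((w i - a i)^2 - (w i - b i)^2) ≥ 0 := by
      rw [hTi]
      have : (w i ^ 2 - (a i + b i - w i) ^ 2) * ((w i - a i) ^ 2 - (w i - b i) ^ 2)
        = ((b i)^2 - (a i)^2) * (2 * w i - a i - b i)^2 := by ring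
      rw [this]
      exact mul_nonneg (sub_nonneg.2 (sq_le_sq.2 hle)) (sq_nonneg _)
    have hT1 : |T w i| ≤ |w i| → h (T w) ≤ h w := fun H => hmono i _ _ (hTj w) H
    have hT2 : |w i| ≤ |T w i| → h w ≤ h (T w) := fun H =>
      hmono i _ _ (fun j hj => (hTj w j hj).symm) H
    have hP1 : |w i - b i| ≤ |w i - a i| → p (w - a) ≤ p (w - b) := fun H =>
      hpuni i _ _ (fun j hj => by simp [hab j hj]) H
    have hP2 : |w i - a i| ≤ |w i - b i| → p (w - b) ≤ p (w - a) := fun H =>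
      hpuni i _ _ (fun j hj => by simp [hab j hj]) H
    simp only [← sq_le_sq] at hT1 hT2 hP1 hP2
    have : 0 ≤ (h w - h (T w)) * (p (w - b) - p (w - a)) := by
      rcases lt_trichotomy ((w i)^2) ((T w i)^2) with H | H | H
      · have := hT2 H.le
        have := hP2 (by nlinarith)
        nlinarith
      · have := hT2 H.le
        have := hT1 H.ge
        have : h w - h (T w) = 0 := by linarith
        simp [this]
      · have := hT1 H.le
        have := hP1 (by nlinarith)
        nlinarith
    show 0 ≤ _
    linarith
  have r1 : Integrable (fun w => h w * p (w - b) - h w * p (w - a)) := (hi b).sub (hi a)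
  have r2 : Integrable (fun w => h (T w) * p (w - b) - h (T w) * p (w - a)) :=
    (hi' b).sub (hi' a)
  rw [integral_sub r1 r2, integral_sub (hi b) (hi a),
    integral_sub (hi' b) (hi' a), q1, q2] at hpos
  linarith

/-- Monotonicity of the smoothed cost (Lemma 4): for an even, coordinatewise unimodal
density `p`, a bounded, measurable, even, coordinatewise nondecreasing-in-absolute-value
`h`, and a diagonal matrix `Λ`, the function `s ↦ ∫ h(Λs + z) p(z) dz` is even and
coordinatewise nondecreasing in absolute value. -/
theorem smoothed_cost_monotone
    (n : ℕ) (hn : 1 ≤ n) (p : (Fin n → ℝ) → ℝ)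
    (hpmeas : Measurable p) (hpnonneg : ∀ z, 0 ≤ p z)
    (hpint : (∫ z : Fin n → ℝ, p z) = 1)
    (hpeven : IsEvenFun n p) (hpuni : CoordUnimodal n p)
    (h : (Fin n → ℝ) → ℝ) (hmeas : Measurable h)
    (hbdd : ∃ C : ℝ, ∀ y, |h y| ≤ C)
    (heven : IsEvenFun n h) (hmono : CoordNondecAbs n h)
    (Λ : Matrix (Fin n) (Fin n) ℝ) (hΛ : Λ.IsDiag) :
    IsEvenFun n (fun s => ∫ z : Fin n → ℝ, h (Λ.mulVec s + z) * p z) ∧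
    CoordNondecAbs n (fun s => ∫ z : Fin n → ℝ, h (Λ.mulVec s + z) * p z) := by
  obtain ⟨C, hC⟩ := hbdd
  have hpi : Integrable p := by
    by_contra H
    rw [integral_undef H] at hpint
    exact zero_ne_one hpint
  have hk := key_mono n p hpmeas hpi hpuni h hmeas C hC hmono
  constructor
  · intro s
    show ∫ z : Fin n → ℝ, h (Λ.mulVec (-s) + z) * p z = ∫ z : Fin n → ℝ, h (Λ.mulVec s + z) * p z
    rw [← integral_neg_eq_self]
    congr 1
    ext z
    rw [hpeven z, Matrix.mulVec_neg, ← neg_add, heven]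
  · intro i u v huv hle
    have hd : ∀ (s : Fin n → ℝ) j, Λ.mulVec s j = Λ j j * s j := by
      intro s j
      rw [Matrix.mulVec, dotProduct, Finset.sum_eq_single j]
      · intro k _ hk
        rw [hΛ hk.symm, zero_mul]
      · simp
    refine hk i _ _ (fun j hj => ?_) ?_
    · rw [hd, hd, huv j hj]
    · rw [hd, hd, abs_mul, abs_mul]
      exact mul_le_mul_of_nonneg_left hle (abs_nonneg _)
end

section
/- Monotonicity of the value-iteration functions in transformed coordinates (Proposition 4): let p : ℝⁿ → [0,∞) be a measurable probability density (∫p = 1) that is even and coordinatewise unimodal, let Λ be a diagonal real n×n matrix, let θ > 0, and let q : ℝⁿ → ℝ be a nonnegative measurable function that is even and coordinatewise nondecreasing in absolute value (in the paper, q(s) = sᵀΛUᵀΣUΛs). Define J_0 ≡ 0 and, for t ≥ 0, J_{t+1}(s) = min( θ + ∫_{ℝⁿ} J_t(y) p(y) dy , q(s) + ∫_{ℝⁿ} J_t(y) p(y − Λs) dy ). Then for every t ≥ 0, J_t is even and coordinatewise nondecreasing in absolute value. -/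
open MeasureTheory Matrix

/-- The value iteration in transformed coordinates: `J_0 ≡ 0` and
`J_{t+1}(s) = min(θ + ∫ J_t(y) p(y) dy, q(s) + ∫ J_t(y) p(y − Λs) dy)`. -/
noncomputable def valueIterT (n : ℕ) (p : (Fin n → ℝ) → ℝ) (Λ : Matrix (Fin n) (Fin n) ℝ)
    (θ : ℝ) (q : (Fin n → ℝ) → ℝ) : ℕ → (Fin n → ℝ) → ℝ
  | 0 => fun _ => 0
  | t + 1 => fun s =>
      min (θ + ∫ y : Fin n → ℝ, valueIterT n p Λ θ q t y * p y)
        (q s + ∫ y : Fin n → ℝ, valueIterT n p Λ θ q t y * p (y - Λ.mulVec s))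


/-- Reflection of the `i`-th coordinate: `y_i ↦ w - y_i`. -/
noncomputable def reflCoord (n : ℕ) (i : Fin n) (w : ℝ) (y : Fin n → ℝ) : Fin n → ℝ :=
  fun j => if j = i then w - y j else y j

theorem reflCoord_measurePreserving (n : ℕ) (i : Fin n) (w : ℝ) :
    MeasurePreserving (reflCoord n i w) volume volume := by
  have h := volume_preserving_pi (ι := Fin n) (α' := fun _ => ℝ) (β' := fun _ => ℝ)
    (f := fun j x => if j = i then w - x else x) (by
      intro j
      by_cases hj : j = i
      · simpa [hj] using Measure.measurePreserving_sub_left (volume : Measure ℝ) w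
      · simp only [hj, if_false]
        exact MeasurePreserving.id (volume : Measure ℝ))
  exact h

theorem reflCoord_invol (n : ℕ) (i : Fin n) (w : ℝ) :
    Function.Involutive (reflCoord n i w) := by
  intro y
  funext j
  by_cases hj : j = i <;> simp [reflCoord, hj]

theorem integral_reflCoord (n : ℕ) (i : Fin n) (w : ℝ) (g : (Fin n → ℝ) → ℝ) :
    ∫ y, g (reflCoord n i w y) = ∫ y, g y := by
  have hm := reflCoord_measurePreserving n i w
  exact hm.integral_comp
    (MeasurableEquiv.ofInvolutive _ (reflCoord_invol n i w) hm.measurable).measurableEmbedding g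

theorem shift_integrable (n : ℕ) (p J : (Fin n → ℝ) → ℝ) (hp : Integrable p)
    (hJ : Measurable J) (C : ℝ) (h0 : ∀ y, 0 ≤ J y) (hC : ∀ y, J y ≤ C) (c : Fin n → ℝ) :
    Integrable (fun y => J y * p (y - c)) := by
  refine (hp.comp_sub_right c).bdd_mul (c := C) hJ.aestronglyMeasurable ?_
  filter_upwards with y
  rw [Real.norm_eq_abs, abs_of_nonneg (h0 y)]
  exact hC y

theorem shift_mono (n : ℕ) (p J : (Fin n → ℝ) → ℝ) (hp : Integrable p)
    (hpuni : CoordUnimodal n p)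
    (hJ : Measurable J) (C : ℝ) (h0 : ∀ y, 0 ≤ J y) (hC : ∀ y, J y ≤ C)
    (hJm : CoordNondecAbs n J) :
    CoordNondecAbs n (fun c => ∫ y, J y * p (y - c)) := by
  intro i c d hcd hi
  have hI := shift_integrable n p J hp hJ C h0 hC
  set R := reflCoord n i (c i + d i) with hR
  have hRi : ∀ y, R y i = c i + d i - y i := fun y => by simp [hR, reflCoord]
  have hRj : ∀ y j, j ≠ i → R y j = y j := fun y j hj => by simp [hR, reflCoord, hj]
  have hpeq : ∀ u v : Fin n → ℝ, (∀ j, j ≠ i → u j = v j) → |u i| = |v i| → p u = p v :=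
    fun u v h1 h2 => le_antisymm (hpuni i v u (fun j hj => (h1 j hj).symm) h2.symm.le)
      (hpuni i u v h1 h2.le)
  have e1 : ∀ y, p (R y - d) = p (y - c) := fun y => by
    apply hpeq
    · intro j hj; simp [hRj y j hj, hcd j hj]
    · simp only [Pi.sub_apply, hRi]; rw [← abs_neg]; congr 1; ring
  have e2 : ∀ y, p (R y - c) = p (y - d) := fun y => by
    apply hpeq
    · intro j hj; simp [hRj y j hj, hcd j hj]
    · simp only [Pi.sub_apply, hRi]; rw [← abs_neg]; congr 1; ring
  have hmp := reflCoord_measurePreserving n i (c i + d i)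
  have r1 : ∫ y, J (R y) * p (y - c) = ∫ y, J y * p (y - d) := by
    rw [← integral_reflCoord n i (c i + d i) (fun y => J y * p (y - d))]
    simp only [← hR, e1]
  have r2 : ∫ y, J (R y) * p (y - d) = ∫ y, J y * p (y - c) := by
    rw [← integral_reflCoord n i (c i + d i) (fun y => J y * p (y - c))]
    simp only [← hR, e2]
  have hI2 := shift_integrable n p (fun y => J (R y)) hp (hJ.comp hmp.measurable) C
    (fun y => h0 _) (fun y => hC _)
  have key : ∀ y, 0 ≤ (J y * p (y - d) - J y * p (y - c))
      - (J (R y) * p (y - d) - J (R y) * p (y - c)) := by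
    intro y
    have hfac : (J y * p (y - d) - J y * p (y - c))
      - (J (R y) * p (y - d) - J (R y) * p (y - c)) =
      (J y - J (R y)) * (p (y - d) - p (y - c)) := by ring
    rw [hfac]
    have hprod : 0 ≤ ((y i - c i)^2 - (y i - d i)^2) * ((y i)^2 - (c i + d i - y i)^2) := by
      have h1 : ((y i - c i)^2 - (y i - d i)^2) * ((y i)^2 - (c i + d i - y i)^2)
        = ((d i)^2 - (c i)^2) * (2 * y i - c i - d i)^2 := by ring
      rw [h1]
      exact mul_nonneg (sub_nonneg.2 (sq_le_sq.2 hi)) (sq_nonneg _)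
    have A1 : (y i - d i)^2 ≤ (y i - c i)^2 → p (y - c) ≤ p (y - d) := fun h =>
      hpuni i _ _ (fun j hj => by simp [hcd j hj]) (sq_le_sq.1 h)
    have A2 : (y i - c i)^2 ≤ (y i - d i)^2 → p (y - d) ≤ p (y - c) := fun h =>
      hpuni i _ _ (fun j hj => by simp [hcd j hj]) (sq_le_sq.1 h)
    have B1 : (c i + d i - y i)^2 ≤ (y i)^2 → J (R y) ≤ J y := fun h =>
      hJm i _ _ (fun j hj => hRj y j hj) (by rw [hRi]; exact sq_le_sq.1 h)
    have B2 : (y i)^2 ≤ (c i + d i - y i)^2 → J y ≤ J (R y) := fun h =>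
      hJm i _ _ (fun j hj => (hRj y j hj).symm) (by rw [hRi]; exact sq_le_sq.1 h)
    rcases lt_trichotomy ((y i - c i)^2) ((y i - d i)^2) with h | h | h
    · have h2 : (y i)^2 ≤ (c i + d i - y i)^2 := by
        by_contra h3
        push Not at h3
        nlinarith [mul_pos (sub_pos.2 h) (sub_pos.2 h3)]
      exact mul_nonneg_of_nonpos_of_nonpos (sub_nonpos.2 (B2 h2)) (sub_nonpos.2 (A2 h.le))
    · rw [le_antisymm (A2 h.le) (A1 h.ge)]; simp
    · have h2 : (c i + d i - y i)^2 ≤ (y i)^2 := by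
        by_contra h3
        push Not at h3
        nlinarith [mul_pos (sub_pos.2 h) (sub_pos.2 h3)]
      exact mul_nonneg (sub_nonneg.2 (B1 h2)) (sub_nonneg.2 (A1 h.le))
  have hint : 0 ≤ ∫ y, ((J y * p (y - d) - J y * p (y - c))
      - (J (R y) * p (y - d) - J (R y) * p (y - c))) := integral_nonneg (fun y => key y)
  have s1 : Integrable (fun y => J y * p (y - d) - J y * p (y - c)) := (hI d).sub (hI c)
  have s2 : Integrable (fun y => J (R y) * p (y - d) - J (R y) * p (y - c)) :=
    (hI2 d).sub (hI2 c)
  rw [integral_sub s1 s2, integral_sub (hI d) (hI c),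
    integral_sub (hI2 d) (hI2 c), r1, r2] at hint
  show ∫ y, J y * p (y - c) ≤ ∫ y, J y * p (y - d)
  linarith

theorem mulVec_isDiag (n : ℕ) (Λ : Matrix (Fin n) (Fin n) ℝ) (hΛ : Λ.IsDiag)
    (s : Fin n → ℝ) (i : Fin n) : Λ.mulVec s i = Λ i i * s i := by
  rw [Matrix.mulVec, dotProduct]
  refine Finset.sum_eq_single i (fun j _ hj => ?_) (by simp)
  rw [hΛ hj.symm, zero_mul]

/-- Monotonicity of the value-iteration functions in transformed coordinates
(Proposition 4): each `J_t` is even and coordinatewise nondecreasing in absolute value. -/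
theorem valueIterT_even_and_monotone
    (n : ℕ) (hn : 1 ≤ n) (p : (Fin n → ℝ) → ℝ)
    (hpmeas : Measurable p) (hpnonneg : ∀ z, 0 ≤ p z)
    (hpint : (∫ z : Fin n → ℝ, p z) = 1)
    (hpeven : IsEvenFun n p) (hpuni : CoordUnimodal n p)
    (Λ : Matrix (Fin n) (Fin n) ℝ) (hΛ : Λ.IsDiag)
    (θ : ℝ) (hθ : 0 < θ)
    (q : (Fin n → ℝ) → ℝ) (hqmeas : Measurable q) (hqnonneg : ∀ s, 0 ≤ q s)
    (hqeven : IsEvenFun n q) (hqmono : CoordNondecAbs n q) :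
    ∀ t : ℕ, IsEvenFun n (valueIterT n p Λ θ q t) ∧
      CoordNondecAbs n (valueIterT n p Λ θ q t) := by
  have hp : Integrable p := by
    by_contra h
    rw [integral_undef h] at hpint
    exact zero_ne_one hpint
  suffices H : ∀ t : ℕ, Measurable (valueIterT n p Λ θ q t) ∧
      (∀ y, 0 ≤ valueIterT n p Λ θ q t y) ∧ (∃ C, ∀ y, valueIterT n p Λ θ q t y ≤ C) ∧
      IsEvenFun n (valueIterT n p Λ θ q t) ∧ CoordNondecAbs n (valueIterT n p Λ θ q t) from
    fun t => (H t).2.2.2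
  intro t
  induction t with
  | zero =>
    refine ⟨measurable_const, fun _ => le_rfl, ⟨0, fun _ => le_rfl⟩, fun _ => rfl, ?_⟩
    intro _ _ _ _ _
    exact le_rfl
  | succ t ih =>
    obtain ⟨hJ, h0, ⟨C, hC⟩, hev, hmo⟩ := ih
    set J := valueIterT n p Λ θ q t with hJdef
    have hstep : valueIterT n p Λ θ q (t + 1) = fun s =>
      min (θ + ∫ y : Fin n → ℝ, J y * p y)
        (q s + ∫ y : Fin n → ℝ, J y * p (y - Λ.mulVec s)) := rfl
    rw [hstep]
    have hΛm : Measurable (fun s : Fin n → ℝ => Λ.mulVec s) :=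
      (Continuous.matrix_mulVec continuous_const continuous_id).measurable
    refine ⟨?_, ?_, ⟨_, fun s => min_le_left _ _⟩, ?_, ?_⟩
    · refine measurable_const.min (hqmeas.add ?_)
      have hf : Measurable (fun z : (Fin n → ℝ) × (Fin n → ℝ) =>
          J z.2 * p (z.2 - Λ.mulVec z.1)) :=
        (hJ.comp measurable_snd).mul
          (hpmeas.comp (measurable_snd.sub (hΛm.comp measurable_fst)))
      exact hf.stronglyMeasurable.integral_prod_right.measurable
    · intro s
      refine le_min ?_ ?_
      · exact add_nonneg hθ.le (integral_nonneg fun y => mul_nonneg (h0 y) (hpnonneg _))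
      · exact add_nonneg (hqnonneg s) (integral_nonneg fun y => mul_nonneg (h0 y) (hpnonneg _))
    · intro s
      have h1 : ∫ y, J y * p (y - Λ.mulVec (-s)) = ∫ y, J y * p (y - Λ.mulVec s) := by
        rw [← integral_neg_eq_self (fun y => J y * p (y - Λ.mulVec (-s)))]
        refine integral_congr_ae (Filter.Eventually.of_forall fun y => ?_)
        show J (-y) * p (-y - Λ.mulVec (-s)) = J y * p (y - Λ.mulVec s)
        rw [hev y, ← hpeven (y - Λ.mulVec s), Matrix.mulVec_neg]
        congr 2
        abel
      show min _ (q (-s) + ∫ y, J y * p (y - Λ.mulVec (-s))) = min _ _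
      rw [h1, hqeven s]
    · intro i u v huv hi
      refine min_le_min le_rfl (add_le_add (hqmono i u v huv hi) ?_)
      refine shift_mono n p J hp hpuni hJ C h0 hC hmo i (Λ.mulVec u) (Λ.mulVec v) ?_ ?_
      · intro j hj
        rw [mulVec_isDiag n Λ hΛ, mulVec_isDiag n Λ hΛ, huv j hj]
      · rw [mulVec_isDiag n Λ hΛ, mulVec_isDiag n Λ hΛ, abs_mul, abs_mul]
        exact mul_le_mul_of_nonneg_left hi (abs_nonneg _)
end

section
/- Threshold structure of the value-of-information scheduling law (core of Theorem 3): let p : ℝⁿ → [0,∞) be a measurable probability density (∫p = 1) that is even and coordinatewise unimodal, let Λ be a diagonal real n×n matrix, let θ > 0, let q : ℝⁿ → ℝ be a nonnegative measurable function that is even and coordinatewise nondecreasing in absolute value, and let h : ℝⁿ → ℝ be bounded, measurable, even, and coordinatewise nondecreasing in absolute value. Define VoI(s) = q(s) + ∫_{ℝⁿ} h(Λs + z) p(z) dz − θ − ∫_{ℝⁿ} h(z) p(z) dz. Then VoI is even and coordinatewise nondecreasing in absolute value; consequently, for every index i and all u, v ∈ ℝⁿ with u_j = v_j for all j ≠ i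 and |u_i| ≤ |v_i|, VoI(u) ≥ 0 implies VoI(v) ≥ 0. -/
open MeasureTheory Matrix

theorem voi_flip_integral (n : ℕ) (i : Fin n) (F : (Fin n → ℝ) → ℝ) (hF : Measurable F) :
    (∫ z : Fin n → ℝ, F (fun j => (if j = i then (fun t : ℝ => -t) else id) (z j)))
      = ∫ z : Fin n → ℝ, F z := by
  have hmp : MeasurePreserving
      (fun (z : Fin n → ℝ) (j : Fin n) => (if j = i then (fun t : ℝ => -t) else id) (z j)) := by
    apply volume_preserving_pi (f := fun j => (if j = i then (fun t : ℝ => -t) else id))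
    intro j
    by_cases hj : j = i
    · simp only [hj, if_true]
      exact Measure.measurePreserving_neg _
    · simp only [hj, if_false]
      exact MeasurePreserving.id _
  have h2 := integral_map (μ := (volume : Measure (Fin n → ℝ))) hmp.measurable.aemeasurable
    (f := F) hF.aestronglyMeasurable
  rw [hmp.map_eq] at h2
  exact h2.symm

theorem voi_conv_mono (n : ℕ) (p : (Fin n → ℝ) → ℝ)
    (hpmeas : Measurable p) (hpi : Integrable p) (hpuni : CoordUnimodal n p)
    (h : (Fin n → ℝ) → ℝ) (hmeas : Measurable h)
    (hbdd : ∃ C : ℝ, ∀ y, |h y| ≤ C) (hmono : CoordNondecAbs n h) :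
    CoordNondecAbs n (fun w => ∫ z : Fin n → ℝ, h (w + z) * p z) := by
  intro i u v huv hle
  obtain ⟨C, hC⟩ := hbdd
  let e : ℝ → Fin n → ℝ := fun s => Pi.single i s
  let w : Fin n → ℝ := u - e (u i)
  have hes : ∀ s j, e s j = if j = i then s else 0 := fun s j => by
    simp [e, Pi.single_apply]
  have hwi : w i = 0 := by simp [w, e]
  have hwu : u = w + e (u i) := by simp [w]
  have hwv : v = w + e (v i) := by
    ext j
    by_cases hj : j = i
    · subst hj; simp [hwi, hes]
    · simp [w, hes, hj, huv j hj]
  let A : ℝ → ℝ → ℝ := fun s r => ∫ y, h (w + e s + y) * p (y + e r)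
  have hadd : ∀ s c, e (s + c) = e s + e c := fun s c => Pi.single_add _ _ _
  have hint : ∀ s r, Integrable (fun y => h (w + e s + y) * p (y + e r)) := by
    intro s r
    refine (hpi.comp_add_right (e r)).bdd_mul (c := C) ?_ ?_
    · exact (hmeas.comp (measurable_const.add measurable_id)).aestronglyMeasurable
    · exact Filter.Eventually.of_forall fun y => hC _
  have htr : ∀ s r c, A (s + c) (r + c) = A s r := by
    intro s r c
    have := integral_add_right_eq_self (μ := (volume : Measure (Fin n → ℝ)))
      (fun y => h (w + e s + y) * p (y + e r)) (e c)
    simp only [A]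
    rw [← this]
    congr 1; ext y
    rw [hadd, hadd]
    congr 2 <;> abel
  have hfl : ∀ s r, A (-s) (-r) = A s r := by
    intro s r
    simp only [A]
    rw [← voi_flip_integral n i (fun y => h (w + e s + y) * p (y + e r))
      (by fun_prop)]
    congr 1; ext y
    congr 1
    · have hj : ∀ j, j ≠ i → (w + e (-s) + y) j = (w + e s + fun j => (if j = i then (fun t : ℝ => -t) else id) (y j)) j := by
        intro j hj; simp [hes, hj]
      have hi : |(w + e (-s) + y) i| = |(w + e s + fun j => (if j = i then (fun t : ℝ => -t) else id) (y j)) i| := by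
        simp only [Pi.add_apply, hes, hwi, if_true]
        rw [← abs_neg]; congr 1; ring
      exact le_antisymm (hmono i _ _ hj hi.le) (hmono i _ _ (fun j h => (hj j h).symm) hi.ge)
    · have hj : ∀ j, j ≠ i → (y + e (-r)) j = ((fun j => (if j = i then (fun t : ℝ => -t) else id) (y j)) + e r) j := by
        intro j hj; simp [hes, hj]
      have hi : |(y + e (-r)) i| = |((fun j => (if j = i then (fun t : ℝ => -t) else id) (y j)) + e r) i| := by
        simp only [Pi.add_apply, hes, if_true]
        rw [← abs_neg]; congr 1; ring
      exact le_antisymm (hpuni i _ _ (fun j h => (hj j h).symm) hi.ge) (hpuni i _ _ hj hi.le)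
  have he0 : e 0 = 0 := Pi.single_zero _
  have hGu : (∫ z : Fin n → ℝ, h (u + z) * p z) = A (u i) 0 := by
    simp only [A, he0, add_zero, ← hwu]
  have hGv : (∫ z : Fin n → ℝ, h (v + z) * p z) = A (v i) 0 := by
    simp only [A, he0, add_zero, ← hwv]
  show (∫ z : Fin n → ℝ, h (u + z) * p z) ≤ ∫ z : Fin n → ℝ, h (v + z) * p z
  rw [hGu, hGv]
  generalize u i = a at *
  generalize v i = b at *
  obtain ⟨d, hd⟩ : ∃ d, d = (b - a) / 2 := ⟨_, rfl⟩
  obtain ⟨m, hm⟩ : ∃ m, m = (a + b) / 2 := ⟨_, rfl⟩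
  have h1 : A b 0 = A d (-m) := by
    rw [← htr b 0 (-m)]; congr 1 <;> rw [hm] <;> (try rw [hd]) <;> ring
  have h2 : A a 0 = A (-d) (-m) := by
    rw [← htr a 0 (-m)]; congr 1 <;> rw [hm] <;> (try rw [hd]) <;> ring
  have h3 : A (-d) m = A d (-m) := by rw [← hfl, neg_neg]
  have h4 : A d m = A (-d) (-m) := (hfl d m).symm
  have hdm : 0 ≤ d * m := by
    have := sq_le_sq.mpr hle
    rw [hd, hm]; nlinarith
  have key : 0 ≤ ∫ y, ((h (w + e d + y) * p (y + e (-m)) - h (w + e d + y) * p (y + e m))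
      - (h (w + e (-d) + y) * p (y + e (-m)) - h (w + e (-d) + y) * p (y + e m))) := by
    apply integral_nonneg
    intro y
    have hh : ∀ s s', |y i + s| ≤ |y i + s'| → h (w + e s + y) ≤ h (w + e s' + y) := by
      intro s s' hs
      apply hmono i
      · intro j hj; simp [hes, hj]
      · simp only [Pi.add_apply, hes, hwi, if_true, zero_add]
        rwa [add_comm s, add_comm s']
    have hp : ∀ s s', |y i + s| ≤ |y i + s'| → p (y + e s') ≤ p (y + e s) := by
      intro s s' hs
      apply hpuni i
      · intro j hj; simp [hes, hj]
      · simpa only [Pi.add_apply, hes, if_true] using hs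
    have ab : ∀ c, 0 ≤ y i * c → |y i + -c| ≤ |y i + c| := by
      intro c hc; rw [← sq_le_sq]; nlinarith
    have ab' : ∀ c, y i * c ≤ 0 → |y i + c| ≤ |y i + -c| := by
      intro c hc; rw [← sq_le_sq]; nlinarith
    have fin : 0 ≤ (h (w + e d + y) - h (w + e (-d) + y)) * (p (y + e (-m)) - p (y + e m)) := by
      have hprod : 0 ≤ (y i * d) * (y i * m) := by
        have : (y i * d) * (y i * m) = (y i)^2 * (d * m) := by ring
        rw [this]; positivity
      have pos : 0 ≤ y i * d → 0 ≤ y i * m →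
          0 ≤ (h (w + e d + y) - h (w + e (-d) + y)) * (p (y + e (-m)) - p (y + e m)) :=
        fun x1 x2 => mul_nonneg (sub_nonneg.2 (hh _ _ (ab _ x1))) (sub_nonneg.2 (hp _ _ (ab _ x2)))
      have neg : y i * d ≤ 0 → y i * m ≤ 0 →
          0 ≤ (h (w + e d + y) - h (w + e (-d) + y)) * (p (y + e (-m)) - p (y + e m)) :=
        fun x1 x2 => mul_nonneg_of_nonpos_of_nonpos (sub_nonpos.2 (hh _ _ (ab' _ x1)))
          (sub_nonpos.2 (hp _ _ (ab' _ x2)))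
      rcases mul_nonneg_iff.1 hprod with ⟨x1, x2⟩ | ⟨x1, x2⟩
      · exact pos x1 x2
      · exact neg x1 x2
    show (0 : ℝ) ≤ _
    linarith
  have hs : ∀ s r s' r', Integrable (fun y => h (w + e s + y) * p (y + e r)
      - h (w + e s' + y) * p (y + e r')) := fun s r s' r' => (hint s r).sub (hint s' r')
  rw [integral_sub (hs _ _ _ _) (hs _ _ _ _),
    integral_sub (hint _ _) (hint _ _), integral_sub (hint _ _) (hint _ _)] at key
  change 0 ≤ (A d (-m) - A d m) - (A (-d) (-m) - A (-d) m) at key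
  rw [h1, h2]
  linarith

/-- Threshold structure of the value-of-information scheduling law (core of Theorem 3):
the VoI function is even and coordinatewise nondecreasing in absolute value, so if
transmission occurs at `u` then it occurs at every `v` that dominates `u` coordinatewise
in absolute value. -/
theorem voi_threshold_structure
    (n : ℕ) (hn : 1 ≤ n) (p : (Fin n → ℝ) → ℝ)
    (hpmeas : Measurable p) (hpnonneg : ∀ z, 0 ≤ p z)
    (hpint : (∫ z : Fin n → ℝ, p z) = 1)
    (hpeven : IsEvenFun n p) (hpuni : CoordUnimodal n p)
    (Λ : Matrix (Fin n) (Fin n) ℝ) (hΛ : Λ.IsDiag)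
    (θ : ℝ) (hθ : 0 < θ)
    (q : (Fin n → ℝ) → ℝ) (hqmeas : Measurable q) (hqnonneg : ∀ s, 0 ≤ q s)
    (hqeven : IsEvenFun n q) (hqmono : CoordNondecAbs n q)
    (h : (Fin n → ℝ) → ℝ) (hmeas : Measurable h)
    (hbdd : ∃ C : ℝ, ∀ y, |h y| ≤ C)
    (heven : IsEvenFun n h) (hmono : CoordNondecAbs n h)
    (VoI : (Fin n → ℝ) → ℝ)
    (hVoI : ∀ s : Fin n → ℝ,
      VoI s = q s + (∫ z : Fin n → ℝ, h (Λ.mulVec s + z) * p z) - θ -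
        ∫ z : Fin n → ℝ, h z * p z) :
    IsEvenFun n VoI ∧ CoordNondecAbs n VoI ∧
    ∀ (i : Fin n) (u v : Fin n → ℝ), (∀ j, j ≠ i → u j = v j) → |u i| ≤ |v i| →
      0 ≤ VoI u → 0 ≤ VoI v := by
  have hpi : Integrable p := by
    by_contra hc
    rw [integral_undef hc] at hpint
    exact zero_ne_one hpint
  have hG := voi_conv_mono n p hpmeas hpi hpuni h hmeas hbdd hmono
  have hmv : ∀ s j, Λ.mulVec s j = Λ j j * s j := by
    intro s j
    rw [← hΛ.diagonal_diag, mulVec_diagonal]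
    simp
  have hmonoV : CoordNondecAbs n VoI := by
    intro i u v huv hle
    have h1 := hqmono i u v huv hle
    have h2 := hG i (Λ.mulVec u) (Λ.mulVec v)
      (fun j hj => by rw [hmv, hmv, huv j hj])
      (by rw [hmv, hmv, abs_mul, abs_mul]; gcongr)
    simp only at h2
    rw [hVoI, hVoI]
    linarith
  refine ⟨?_, hmonoV, fun i u v huv hle h0 => h0.trans (hmonoV i u v huv hle)⟩
  intro s
  rw [hVoI, hVoI, hqeven s]
  have : (∫ z : Fin n → ℝ, h (Λ.mulVec (-s) + z) * p z)
      = ∫ z : Fin n → ℝ, h (Λ.mulVec s + z) * p z := by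
    rw [← integral_neg_eq_self]
    congr 1; ext z
    rw [hpeven z, mulVec_neg, ← neg_add, heven]
  rw [this]
end

section
/- Range of the optimal threshold (part of Theorem 3): let p : ℝⁿ → [0,∞) be a measurable probability density (∫p = 1) that is even and coordinatewise unimodal, let Λ be a diagonal real n×n matrix, let θ > 0, and let h : ℝⁿ → ℝ be a measurable function that is even, coordinatewise nondecreasing in absolute value, and satisfies 0 ≤ h(y) ≤ θ for all y. Then for every s ∈ ℝⁿ, 0 ≤ θ + ∫_{ℝⁿ} h(z) p(z) dz − ∫_{ℝⁿ} h(Λs + z) p(z) dz ≤ θ. -/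
open MeasureTheory Matrix

theorem step_aux (n : ℕ) (p : (Fin n → ℝ) → ℝ)
    (hpmeas : Measurable p) (hpi : Integrable p)
    (hpuni : CoordUnimodal n p) (θ : ℝ)
    (h : (Fin n → ℝ) → ℝ) (hmeas : Measurable h) (hmono : CoordNondecAbs n h)
    (hbound : ∀ y : Fin n → ℝ, 0 ≤ h y ∧ h y ≤ θ)
    (b : Fin n → ℝ) (i : Fin n) (hb : b i = 0) (t : ℝ) :
    (∫ z : Fin n → ℝ, h (b + z) * p z) ≤ ∫ z : Fin n → ℝ, h (Function.update b i t + z) * p z := by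
  set c := Function.update b i t with hc
  have hci : c i = t := by simp [hc]
  have hcj : ∀ j, j ≠ i → c j = b j := fun j hj => by simp [hc, hj]
  let F : Fin n → ℝ → ℝ := fun j x => if j = i then -t - x else x
  let R : (Fin n → ℝ) → (Fin n → ℝ) := fun z j => F j (z j)
  have hRi : ∀ z, R z i = -t - z i := fun z => by simp [R, F]
  have hRj : ∀ z j, j ≠ i → R z j = z j := fun z j hj => by simp [R, F, hj]
  have hR : MeasurePreserving R volume volume := by
    refine volume_preserving_pi (f := F) (fun j => ?_)
    by_cases hj : j = i
    · have : F j = fun x => -t - x := by funext x; simp [F, hj]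
      rw [this]
      exact Measure.measurePreserving_sub_left volume (-t)
    · have : F j = id := by funext x; simp [F, hj]
      rw [this]
      exact MeasurePreserving.id volume
  have hint : ∀ d : Fin n → ℝ, Integrable (fun z => h (d + z) * p z) := by
    intro d
    refine hpi.bdd_mul (c := θ) ?_ ?_
    · exact (hmeas.comp (measurable_const.add measurable_id)).aestronglyMeasurable
    · refine Filter.Eventually.of_forall (fun z => ?_)
      rw [Real.norm_eq_abs, abs_of_nonneg (hbound _).1]
      exact (hbound _).2
  have key : ∀ u v : Fin n → ℝ, (∀ j, j ≠ i → u j = v j) → |u i| = |v i| → h u = h v :=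
    fun u v h1 h2 => le_antisymm (hmono i u v h1 h2.le)
      (hmono i v u (fun j hj => (h1 j hj).symm) h2.ge)
  have e1 : ∀ z, h (c + R z) = h (b + z) := fun z => by
    apply key
    · intro j hj; simp [hRj z j hj, hcj j hj]
    · rw [Pi.add_apply, Pi.add_apply, hRi, hci, hb, ← abs_neg]; congr 1; ring
  have e2 : ∀ z, h (b + R z) = h (c + z) := fun z => by
    apply key
    · intro j hj; simp [hRj z j hj, hcj j hj]
    · rw [Pi.add_apply, Pi.add_apply, hRi, hci, hb, ← abs_neg]; congr 1; ring
  let D : (Fin n → ℝ) → ℝ := fun z => h (c + z) * p z - h (b + z) * p z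
  have hD : Integrable D := (hint c).sub (hint b)
  have hDR : (∫ z, D (R z)) = ∫ z, D z := by
    have h3 := integral_map (μ := volume) hR.measurable.aemeasurable (f := D)
      (by rw [hR.map_eq]; exact hD.aestronglyMeasurable)
    rw [hR.map_eq] at h3
    exact h3.symm
  have hDRi : Integrable (fun z => D (R z)) := hR.integrable_comp_of_integrable hD
  have hpos : 0 ≤ ∫ z, (D z + D (R z)) := by
    refine integral_nonneg (fun z => ?_)
    have : D z + D (R z) = (h (c + z) - h (b + z)) * (p z - p (R z)) := by
      simp only [D, e1, e2]; ring
    change 0 ≤ D z + D (R z)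
    rw [this]
    have hR' : |R z i| = |t + z i| := by rw [hRi, ← abs_neg]; congr 1; ring
    rcases le_total |z i| |t + z i| with hle | hle
    · apply mul_nonneg
      · refine sub_nonneg.2 (hmono i _ _ (fun j hj => by simp [hcj j hj]) ?_)
        simpa [hb, hci] using hle
      · exact sub_nonneg.2 (hpuni i _ _ (fun j hj => (hRj z j hj).symm) (by rwa [hR']))
    · apply mul_nonneg_of_nonpos_of_nonpos
      · refine sub_nonpos.2 (hmono i _ _ (fun j hj => by simp [hcj j hj]) ?_)
        simpa [hb, hci] using hle
      · exact sub_nonpos.2 (hpuni i _ _ (fun j hj => hRj z j hj) (by rwa [hR']))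
  rw [integral_add hD hDRi, hDR] at hpos
  have h4 : (∫ z, D z) = (∫ z, h (c + z) * p z) - ∫ z, h (b + z) * p z :=
    integral_sub (hint c) (hint b)
  linarith

/-- Range of the optimal threshold (part of Theorem 3): for every `s`,
`0 ≤ θ + ∫ h(z) p(z) dz − ∫ h(Λs + z) p(z) dz ≤ θ`. -/
theorem threshold_range
    (n : ℕ) (hn : 1 ≤ n) (p : (Fin n → ℝ) → ℝ)
    (hpmeas : Measurable p) (hpnonneg : ∀ z, 0 ≤ p z)
    (hpint : (∫ z : Fin n → ℝ, p z) = 1)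
    (hpeven : IsEvenFun n p) (hpuni : CoordUnimodal n p)
    (Λ : Matrix (Fin n) (Fin n) ℝ) (hΛ : Λ.IsDiag)
    (θ : ℝ) (hθ : 0 < θ)
    (h : (Fin n → ℝ) → ℝ) (hmeas : Measurable h)
    (heven : IsEvenFun n h) (hmono : CoordNondecAbs n h)
    (hbound : ∀ y : Fin n → ℝ, 0 ≤ h y ∧ h y ≤ θ) :
    ∀ s : Fin n → ℝ,
      0 ≤ θ + (∫ z : Fin n → ℝ, h z * p z) - ∫ z : Fin n → ℝ, h (Λ.mulVec s + z) * p z ∧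
      θ + (∫ z : Fin n → ℝ, h z * p z) - (∫ z : Fin n → ℝ, h (Λ.mulVec s + z) * p z) ≤ θ := by
  intro s
  generalize Λ.mulVec s = a
  have hpi : Integrable p := by
    by_contra hcon
    rw [integral_undef hcon] at hpint
    exact zero_ne_one hpint
  have hmain : ∀ S : Finset (Fin n), (∫ z : Fin n → ℝ, h z * p z) ≤
      ∫ z : Fin n → ℝ, h ((fun j => if j ∈ S then a j else 0) + z) * p z := by
    intro S
    induction S using Finset.induction_on with
    | empty =>
      have : (fun j : Fin n => if j ∈ (∅ : Finset (Fin n)) then a j else 0) = 0 := by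
        funext j; simp
      rw [this]; simp
    | insert i S hi ih =>
      refine ih.trans ?_
      have h1 := step_aux n p hpmeas hpi hpuni θ h hmeas hmono hbound
        (fun j => if j ∈ S then a j else 0) i (by simp [hi]) (a i)
      have h2 : Function.update (fun j => if j ∈ S then a j else 0) i (a i)
          = fun j => if j ∈ insert i S then a j else 0 := by
        funext j
        by_cases hj : j = i
        · subst hj; simp
        · simp [hj]
      rwa [h2] at h1
  have hm := hmain Finset.univ
  simp only [Finset.mem_univ, if_true] at hm
  have h0 : 0 ≤ ∫ z : Fin n → ℝ, h z * p z :=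
    integral_nonneg (fun z => mul_nonneg (hbound z).1 (hpnonneg z))
  have h1 : (∫ z : Fin n → ℝ, h (a + z) * p z) ≤ ∫ z : Fin n → ℝ, θ * p z :=
    integral_mono_of_nonneg
      (Filter.Eventually.of_forall fun z => mul_nonneg (hbound _).1 (hpnonneg z))
      (hpi.const_mul θ)
      (Filter.Eventually.of_forall fun z => mul_le_mul_of_nonneg_right (hbound _).2 (hpnonneg z))
  rw [integral_const_mul, hpint, mul_one] at h1
  constructor <;> linarith
end

section
/- Uniform overlap of the transition densities on bounded sets (total-variation contraction, condition (2) in the proof of Lemma 3, valid on the truncated state space of Proposition 2): let K ⊆ ℝⁿ be a bounded set and define the transition densities p(y | e, δ) = δ·p_Ξ(y) + (1 − δ)·p_Ξ(y − A e) for δ ∈ {0,1}. Then there exists β̄ ∈ (0, 1] such that for all e, e' ∈ K and all δ, δ' ∈ {0,1}, ∫_{ℝⁿ} min( p(y | e, δ), p(y | e', δ') ) dy ≥ β̄; consequently ∫_{ℝⁿ} | p(y | e, δ) − p(y | e', δ') | dy ≤ 2(1 − β̄). -/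
open MeasureTheory Matrix

/-- Transition density of the scheduling MDP:
`p(y | e, δ) = δ·p_Ξ(y) + (1 − δ)·p_Ξ(y − Ae)`. -/
noncomputable def transDensity (n : ℕ) (A Ξ : Matrix (Fin n) (Fin n) ℝ)
    (e : Fin n → ℝ) (δ : ℝ) (y : Fin n → ℝ) : ℝ :=
  δ * gaussDensity n Ξ y + (1 - δ) * gaussDensity n Ξ (y - A.mulVec e)

lemma aux_factor {n : ℕ} {Ξ : Matrix (Fin n) (Fin n) ℝ} (hΞ : Ξ.PosDef) :
    ∃ B : Matrix (Fin n) (Fin n) ℝ, Ξ⁻¹ = Bᵀ * B := by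
  open scoped MatrixOrder in
  obtain ⟨B, hB⟩ := CStarAlgebra.nonneg_iff_eq_star_mul_self.mp hΞ.inv.posSemidef.nonneg
  exact ⟨B, by rw [hB, Matrix.star_eq_conjTranspose, Matrix.conjTranspose_eq_transpose_of_trivial]⟩

lemma aux_integral {n : ℕ} {Ξ : Matrix (Fin n) (Fin n) ℝ} (hΞ : Ξ.PosDef) :
    ∫ y, gaussDensity n Ξ y = 1 := by
  obtain ⟨B, hB⟩ := aux_factor hΞ
  have hd : 0 < Ξ.det := hΞ.det_pos
  have hdet : Ξ.det⁻¹ = B.det ^ 2 := by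
    have := congrArg Matrix.det hB
    rw [Matrix.det_mul, Matrix.det_transpose, Matrix.det_nonsing_inv, Ring.inverse_eq_inv'] at this
    rw [this, sq]
  have hB0 : B.det ≠ 0 := by
    intro h
    rw [h] at hdet
    have := inv_pos.mpr hd
    simp at hdet
    exact hd.ne' hdet
  have hq : ∀ y, y ⬝ᵥ Ξ⁻¹.mulVec y = ∑ i, (B.mulVec y i) ^ 2 := by
    intro y
    rw [hB, ← Matrix.mulVec_mulVec, Matrix.dotProduct_mulVec, Matrix.vecMul_transpose]
    simp [dotProduct, sq]
  have hI : ∫ z : Fin n → ℝ, ∏ i, Real.exp (-(1/2) * (z i) ^ 2) = (2 * Real.pi) ^ ((n : ℝ) / 2) := by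
    rw [integral_fintype_prod_volume_eq_pow (fun x : ℝ => Real.exp (-(1/2) * x ^ 2)), integral_gaussian,
      Real.sqrt_eq_rpow, ← Real.rpow_natCast, ← Real.rpow_mul (by positivity)]
    simp only [Fintype.card_fin]
    congr 1 <;> ring
  have hE : ∫ y : Fin n → ℝ, Real.exp (-(1 / 2) * (y ⬝ᵥ Ξ⁻¹.mulVec y))
      = |B.det⁻¹| * (2 * Real.pi) ^ ((n : ℝ) / 2) := by
    have h1 := Real.map_matrix_volume_pi_eq_smul_volume_pi hB0
    have h2 : ∫ z, (∏ i, Real.exp (-(1/2) * (z i) ^ 2)) ∂(Measure.map (toLin' B) volume)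
        = ∫ y : Fin n → ℝ, ∏ i, Real.exp (-(1/2) * (toLin' B y i) ^ 2) := by
      apply integral_map
      · exact (LinearMap.continuous_of_finiteDimensional _).aemeasurable
      · exact Continuous.aestronglyMeasurable (by fun_prop)
    rw [h1, integral_smul_measure, hI, ENNReal.toReal_ofReal (abs_nonneg _), smul_eq_mul] at h2
    rw [h2]
    congr 1
    ext y
    rw [hq, Finset.mul_sum, Real.exp_sum]
    simp
  unfold gaussDensity
  rw [integral_const_mul, hE]
  have hs : Ξ.det ^ (-(1 : ℝ) / 2) = |B.det| := by
    rw [neg_div, Real.rpow_neg hd.le, ← Real.inv_rpow hd.le, hdet, ← Real.sqrt_eq_rpow,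
      Real.sqrt_sq_eq_abs]
  have hp : (0 : ℝ) < (2 * Real.pi) ^ ((n : ℝ) / 2) := by positivity
  rw [hs, neg_div, Real.rpow_neg (by positivity), abs_inv]
  have : |B.det| ≠ 0 := abs_ne_zero.mpr hB0
  field_simp

lemma aux_integrable {n : ℕ} {Ξ : Matrix (Fin n) (Fin n) ℝ} (hΞ : Ξ.PosDef) :
    Integrable (gaussDensity n Ξ) := by
  by_contra h
  have := aux_integral hΞ
  rw [integral_undef h] at this
  exact zero_ne_one this

lemma aux_q {n : ℕ} {Ξ : Matrix (Fin n) (Fin n) ℝ} (hΞ : Ξ.PosDef) (y v : Fin n → ℝ) :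
    (y - v) ⬝ᵥ Ξ⁻¹.mulVec (y - v) ≤ 2 * (y ⬝ᵥ Ξ⁻¹.mulVec y) + 2 * (v ⬝ᵥ Ξ⁻¹.mulVec v) := by
  have h := hΞ.inv.posSemidef.dotProduct_mulVec_nonneg (y + v)
  simp only [star_trivial, Matrix.mulVec_add, Matrix.mulVec_sub, dotProduct_add, add_dotProduct,
    dotProduct_sub, sub_dotProduct] at h ⊢
  linarith

/-- Uniform overlap of the transition densities on bounded sets (total-variation
contraction on the truncated state space). -/
theorem transition_densities_uniform_overlap
    (n : ℕ) (hn : 1 ≤ n) (A Ξ : Matrix (Fin n) (Fin n) ℝ) (hΞ : Ξ.PosDef)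
    (K : Set (Fin n → ℝ)) (hK : Bornology.IsBounded K) :
    ∃ betaBar : ℝ, 0 < betaBar ∧ betaBar ≤ 1 ∧
      ∀ e ∈ K, ∀ e' ∈ K, ∀ δ δ' : ℝ, (δ = 0 ∨ δ = 1) → (δ' = 0 ∨ δ' = 1) →
        betaBar ≤ (∫ y : Fin n → ℝ,
            min (transDensity n A Ξ e δ y) (transDensity n A Ξ e' δ' y)) ∧
        (∫ y : Fin n → ℝ,
            |transDensity n A Ξ e δ y - transDensity n A Ξ e' δ' y|) ≤
          2 * (1 - betaBar) := by
  have hcont : Continuous (fun e : Fin n → ℝ => A.mulVec e ⬝ᵥ Ξ⁻¹.mulVec (A.mulVec e)) := by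
    fun_prop
  obtain ⟨M, hM⟩ := hK.isCompact_closure.exists_bound_of_continuousOn hcont.continuousOn
  set C : ℝ := (2 * Real.pi) ^ (-(n : ℝ) / 2) * Ξ.det ^ (-(1 : ℝ) / 2) with hC
  have hd : 0 < Ξ.det := hΞ.det_pos
  have hCpos : 0 < C := by positivity
  let h : (Fin n → ℝ) → ℝ := fun y => C * Real.exp (-(y ⬝ᵥ Ξ⁻¹.mulVec y) - max M 0)
  have hlow : ∀ y v : Fin n → ℝ, v ⬝ᵥ Ξ⁻¹.mulVec v ≤ max M 0 → h y ≤ gaussDensity n Ξ (y - v) := by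
    intro y v hv
    have := aux_q hΞ y v
    simp only [h, gaussDensity, ← hC]
    gcongr
    linarith
  have hint := aux_integrable hΞ
  have hhc : Continuous h := by
    simp only [h]; fun_prop
  have hhint : Integrable h := by
    refine hint.mono' hhc.aestronglyMeasurable (Filter.Eventually.of_forall fun y => ?_)
    rw [Real.norm_of_nonneg (by simp only [h]; positivity)]
    simpa using hlow y 0 (by simp)
  have hpos : 0 < ∫ y, h y := by
    have h2 : Integrable (fun y : Fin n → ℝ => Real.exp (-(y ⬝ᵥ Ξ⁻¹.mulVec y) - max M 0)) := by
      have := hhint.const_mul C⁻¹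
      refine this.congr (Filter.Eventually.of_forall fun y => ?_)
      simp only [h]
      field_simp
    simp only [h]
    rw [integral_const_mul]
    exact mul_pos hCpos (integral_exp_pos h2)
  have hrep : ∀ e ∈ K, ∀ δ : ℝ, (δ = 0 ∨ δ = 1) → ∃ v : Fin n → ℝ, v ⬝ᵥ Ξ⁻¹.mulVec v ≤ max M 0 ∧
      transDensity n A Ξ e δ = fun y => gaussDensity n Ξ (y - v) := by
    rintro e he δ (rfl | rfl)
    · refine ⟨A.mulVec e, ?_, ?_⟩
      · exact (le_abs_self _).trans ((hM e (subset_closure he)).trans (le_max_left _ _))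
      · ext y; simp [transDensity]
    · exact ⟨0, by simp, by ext y; simp [transDensity]⟩
  refine ⟨min 1 (∫ y, h y), by positivity, min_le_left _ _, ?_⟩
  intro e he e' he' δ δ' hδ hδ'
  obtain ⟨v, hv, h1⟩ := hrep e he δ hδ
  obtain ⟨w, hw, h2⟩ := hrep e' he' δ' hδ'
  simp only [h1, h2]
  have i1 : Integrable (fun y => gaussDensity n Ξ (y - v)) := hint.comp_sub_right v
  have i2 : Integrable (fun y => gaussDensity n Ξ (y - w)) := hint.comp_sub_right w
  have i3 : Integrable (fun y => min (gaussDensity n Ξ (y - v)) (gaussDensity n Ξ (y - w))) :=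
    i1.inf i2
  have hmin : min 1 (∫ y, h y) ≤
      ∫ y, min (gaussDensity n Ξ (y - v)) (gaussDensity n Ξ (y - w)) :=
    (min_le_right _ _).trans
      (integral_mono hhint i3 fun y => le_min (hlow y v hv) (hlow y w hw))
  refine ⟨hmin, ?_⟩
  have habs : ∀ y, |gaussDensity n Ξ (y - v) - gaussDensity n Ξ (y - w)| =
      gaussDensity n Ξ (y - v) + gaussDensity n Ξ (y - w)
        - 2 * min (gaussDensity n Ξ (y - v)) (gaussDensity n Ξ (y - w)) := by
    intro y
    rcases le_total (gaussDensity n Ξ (y - v)) (gaussDensity n Ξ (y - w)) with hl | hl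
    · rw [min_eq_left hl, abs_of_nonpos (by linarith)]; ring
    · rw [min_eq_right hl, abs_of_nonneg (by linarith)]; ring
  simp only [habs]
  have i4 : Integrable (fun y => gaussDensity n Ξ (y - v) + gaussDensity n Ξ (y - w)) := i1.add i2
  rw [integral_sub i4 (i3.const_mul 2), integral_add i1 i2, integral_const_mul,
    integral_sub_right_eq_self (gaussDensity n Ξ) v, integral_sub_right_eq_self (gaussDensity n Ξ) w,
    aux_integral hΞ]
  linarith
end
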